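/- arXiv:1809.07427 — 2 statements merged into one kernel-verified Lean document; each statement's English description precedes it below -/
import Mathlib

section
/- For any infinite set X, the lattice Con P_X of congruences of the partition monoid P_X is well quasi-ordered under inclusion: there is no strictly descending sequence c₀ > c₁ > c₂ > ⋯ of congruences, and every antichain of congruences (a set of pairwise ≤-incomparable congruences) is finite. (Theorem 6.2 for P_X.) -/
open Cardinal
open scoped symmDiff

namespace PartitionCongruences

variable {X : Type*}

/-- A partition over `X` is a setoid on `X ⊕ X`; `PMon X` is the carrier of the
partition monoid. -/
abbrev PMon (X : Type*) := Setoid (X ⊕ X)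

/-- The set of blocks of a partition. -/
def cl (α : PMon X) : Set (Set (X ⊕ X)) := α.classes

/-- A block of `α` is a transversal if it meets both summands. -/
def IsTransversal (α : PMon X) (B : Set (X ⊕ X)) : Prop :=
  B ∈ α.classes ∧ (∃ x : X, Sum.inl x ∈ B) ∧ (∃ x : X, Sum.inr x ∈ B)

/-- The rank of a partition: the number of its transversals. -/
def rank (α : PMon X) : Cardinal :=
  #{B : Set (X ⊕ X) // IsTransversal α B}

/-- The kernel partition `ᾱ`. -/
def ker (α : PMon X) : Set (Set X) := (Setoid.comap Sum.inl α).classes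

/-- The cokernel partition `α̲`. -/
def coker (α : PMon X) : Set (Set X) := (Setoid.comap Sum.inr α).classes

/-- Left summand to top copy, right summand to middle copy. -/
def dmap (X : Type*) : X ⊕ X → X ⊕ (X ⊕ X) :=
  Sum.elim Sum.inl (fun x => Sum.inr (Sum.inl x))

/-- Left summand to middle copy, right summand to bottom copy. -/
def umap (X : Type*) : X ⊕ X → X ⊕ (X ⊕ X) :=
  Sum.elim (fun x => Sum.inr (Sum.inl x)) (fun x => Sum.inr (Sum.inr x))

/-- Left summand to top copy, right summand to bottom copy. -/
def emap (X : Type*) : X ⊕ X → X ⊕ (X ⊕ X) :=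
  Sum.elim Sum.inl (fun x => Sum.inr (Sum.inr x))

/-- The pushforward of a setoid along a map: the smallest setoid relating `f x` and
`f y` whenever `σ` relates `x` and `y`. -/
def push {A B : Type*} (f : A → B) (σ : Setoid A) : Setoid B :=
  Relation.EqvGen.setoid (fun a b => ∃ x y, σ x y ∧ f x = a ∧ f y = b)

/-- The product of the partition monoid. -/
instance : Mul (PMon X) :=
  ⟨fun α β => Setoid.comap (emap X) (push (dmap X) α ⊔ push (umap X) β)⟩


set_option linter.unusedSimpArgs false
set_option linter.unnecessarySimpa false

universe u

/-- The disjoint union of two setoids. -/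
def sumS {A B : Type*} (r : Setoid A) (s : Setoid B) : Setoid (A ⊕ B) where
  r := Sum.LiftRel r s
  iseqv :=
    { refl := by rintro (x | x) <;> simp [r.refl, s.refl]
      symm := by
        rintro _ _ (h | h)
        · exact .inl (r.symm h)
        · exact .inr (s.symm h)
      trans := by
        rintro _ _ _ (h | h) (h' | h')
        · exact .inl (r.trans h h')
        · exact .inr (s.trans h h') }

section sumS
variable {A B : Type*} (r : Setoid A) (s : Setoid B)

@[simp] lemma sumS_inl_inl (x y : A) : sumS r s (Sum.inl x) (Sum.inl y) ↔ r x y :=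
  Sum.liftRel_inl_inl

@[simp] lemma sumS_inr_inr (x y : B) : sumS r s (Sum.inr x) (Sum.inr y) ↔ s x y :=
  Sum.liftRel_inr_inr

@[simp] lemma sumS_inl_inr (x : A) (y : B) : sumS r s (Sum.inl x) (Sum.inr y) ↔ False :=
  ⟨fun h => Sum.not_liftRel_inl_inr h, False.elim⟩

@[simp] lemma sumS_inr_inl (x : A) (y : B) : sumS r s (Sum.inr y) (Sum.inl x) ↔ False :=
  ⟨fun h => Sum.not_liftRel_inr_inl h, False.elim⟩

end sumS

@[simp] lemma bot_rel {A : Type*} (x y : A) : (⊥ : Setoid A) x y ↔ x = y := Iff.rfl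

@[simp] lemma top_rel {A : Type*} (x y : A) : (⊤ : Setoid A) x y ↔ True := Iff.rfl

@[simp] lemma comap_rel {A B : Type*} (f : A → B) (r : Setoid B) (x y : A) :
    Setoid.comap f r x y ↔ r (f x) (f y) := Iff.rfl

/-- Relabelling of a partition along maps of its upper and its lower points; the points sent to
the extra labels in `Z` and `Z'` are only related when they have the same label. -/
def cmap {P P' Q Q' Z Z' : Type*} (h : P' → P ⊕ Z) (k : Q' → Q ⊕ Z') (ω : Setoid (P ⊕ Q)) :
    Setoid (P' ⊕ Q') :=
  Setoid.comap (Sum.elim (Sum.map Sum.inl Sum.inl ∘ h) (Sum.map Sum.inr Sum.inr ∘ k))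
    (sumS ω (⊥ : Setoid (Z ⊕ Z')))

lemma cmap_def {P P' Q Q' Z Z' : Type*} (h : P' → P ⊕ Z) (k : Q' → Q ⊕ Z') (ω : Setoid (P ⊕ Q))
    (x y : P' ⊕ Q') : cmap h k ω x y ↔ sumS ω (⊥ : Setoid (Z ⊕ Z'))
      (Sum.elim (Sum.map Sum.inl Sum.inl ∘ h) (Sum.map Sum.inr Sum.inr ∘ k) x)
      (Sum.elim (Sum.map Sum.inl Sum.inl ∘ h) (Sum.map Sum.inr Sum.inr ∘ k) y) := Iff.rfl

lemma push_le_iff {A B : Type*} {f : A → B} {σ : Setoid A} {τ : Setoid B} :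
    push f σ ≤ τ ↔ ∀ x y, σ x y → τ (f x) (f y) := by
  constructor
  · intro h x y hxy
    exact h (Relation.EqvGen.rel _ _ ⟨x, y, hxy, rfl, rfl⟩)
  · intro h
    refine Setoid.eqvGen_le ?_
    rintro _ _ ⟨x, y, hxy, rfl, rfl⟩
    exact h x y hxy

lemma push_rel {A B : Type*} (f : A → B) (σ : Setoid A) {x y : A} (h : σ x y) :
    push f σ (f x) (f y) := push_le_iff.1 le_rfl x y h

lemma mul_le {X : Type*} {α β : PMon X} {Y : Type*} (τ : Setoid Y) (f g b : X → Y)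
    (hα : ∀ x y, α x y → τ (Sum.elim f g x) (Sum.elim f g y))
    (hβ : ∀ x y, β x y → τ (Sum.elim g b x) (Sum.elim g b y)) {x y : X ⊕ X}
    (h : (α * β) x y) : τ (Sum.elim f b x) (Sum.elim f b y) := by
  have key : push (dmap X) α ⊔ push (umap X) β ≤
      Setoid.comap (Sum.elim f (Sum.elim g b)) τ := by
    refine sup_le (push_le_iff.2 ?_) (push_le_iff.2 ?_)
    · intro x y hxy
      have := hα x y hxy
      rcases x with x | x <;> rcases y with y | y <;> simpa [dmap] using this
    · intro x y hxy
      have := hβ x y hxy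
      rcases x with x | x <;> rcases y with y | y <;> simpa [umap] using this
  have := key h
  rcases x with x | x <;> rcases y with y | y <;> simpa [emap] using this

lemma mul_upper {X : Type*} (α β : PMon X) {x y : X ⊕ X} (h : α x y) :
    (push (dmap X) α ⊔ push (umap X) β) (dmap X x) (dmap X y) :=
  (le_sup_left : push (dmap X) α ≤ _) (push_rel _ _ h)

lemma mul_lower {X : Type*} (α β : PMon X) {x y : X ⊕ X} (h : β x y) :
    (push (dmap X) α ⊔ push (umap X) β) (umap X x) (umap X y) :=
  (le_sup_right : push (umap X) β ≤ _) (push_rel _ _ h)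

lemma ker_mul {X Z : Type*} (h : X → X ⊕ Z) (α : PMon X) :
    (Setoid.ker (Sum.elim h Sum.inl) : PMon X) * α
      = cmap h (Sum.inl : X → X ⊕ Empty) α := by
  set ξ : PMon X := Setoid.ker (Sum.elim h Sum.inl) with hξ
  have up : ∀ {x m : X}, h x = Sum.inl m → (push (dmap X) ξ ⊔ push (umap X) α)
      (Sum.inl x) (Sum.inr (Sum.inl m)) := fun {x m} hx => by
    have : ξ (Sum.inl x) (Sum.inr m) := by simp [hξ, Setoid.ker_def, hx]
    simpa [dmap] using mul_upper ξ α this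
  ext x y
  constructor
  · intro hxy
    have := mul_le (sumS α (⊥ : Setoid (Z ⊕ Empty))) (Sum.map Sum.inl Sum.inl ∘ h)
      (Sum.inl ∘ Sum.inl) (Sum.inl ∘ Sum.inr) ?_ ?_ hxy
    · rcases x with x | x <;> rcases y with y | y <;> simpa [cmap_def] using this
    · intro x y hxy
      have e : Sum.elim h Sum.inl x = Sum.elim h Sum.inl y := hxy
      have e2 : ∀ z : X ⊕ X, Sum.elim (Sum.map Sum.inl Sum.inl ∘ h) (Sum.inl ∘ Sum.inl) z =
        (Sum.map Sum.inl Sum.inl (Sum.elim h Sum.inl z) : (X ⊕ X) ⊕ (Z ⊕ Empty)) := by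
        rintro (z | z) <;> simp
      rw [e2, e2, e]
    · intro x y hxy
      rcases x with x | x <;> rcases y with y | y <;> simpa using hxy
  · intro hxy
    change (push (dmap X) ξ ⊔ push (umap X) α) (emap X x) (emap X y)
    rw [cmap_def] at hxy
    rcases x with x | x <;> rcases y with y | y
    · rcases hx : h x with m | z <;> rcases hy : h y with m' | z' <;>
        simp [hx, hy] at hxy
      · have := mul_lower ξ α hxy
        exact Setoid.trans' _ (up hx) (Setoid.trans' _ this (Setoid.symm' _ (up hy)))
      · have : ξ (Sum.inl x) (Sum.inl y) := by simp [hξ, Setoid.ker_def, hx, hy, hxy]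
        exact mul_upper ξ α this
    · rcases hx : h x with m | z <;> simp [hx] at hxy
      have := mul_lower ξ α hxy
      exact Setoid.trans' _ (up hx) this
    · rcases hy : h y with m | z <;> simp [hy] at hxy
      have := mul_lower ξ α hxy
      exact Setoid.trans' _ this (Setoid.symm' _ (up hy))
    · simp at hxy
      exact mul_lower ξ α hxy

lemma mul_ker {X Z : Type*} (k : X → X ⊕ Z) (α : PMon X) :
    α * (Setoid.ker (Sum.elim Sum.inl k) : PMon X)
      = cmap (Sum.inl : X → X ⊕ Empty) k α := by
  set ξ : PMon X := Setoid.ker (Sum.elim Sum.inl k) with hξ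
  have dn : ∀ {x m : X}, k x = Sum.inl m → (push (dmap X) α ⊔ push (umap X) ξ)
      (Sum.inr (Sum.inr x)) (Sum.inr (Sum.inl m)) := fun {x m} hx => by
    have : ξ (Sum.inr x) (Sum.inl m) := by simp [hξ, Setoid.ker_def, hx]
    simpa [umap] using mul_lower α ξ this
  ext x y
  constructor
  · intro hxy
    have := mul_le (sumS α (⊥ : Setoid (Empty ⊕ Z))) (Sum.inl ∘ Sum.inl)
      (Sum.inl ∘ Sum.inr) (Sum.map Sum.inr Sum.inr ∘ k) ?_ ?_ hxy
    · rcases x with x | x <;> rcases y with y | y <;> simpa [cmap_def] using this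
    · intro x y hxy
      rcases x with x | x <;> rcases y with y | y <;> simpa using hxy
    · intro x y hxy
      have e : Sum.elim Sum.inl k x = Sum.elim Sum.inl k y := hxy
      have e2 : ∀ z : X ⊕ X, Sum.elim (Sum.inl ∘ Sum.inr) (Sum.map Sum.inr Sum.inr ∘ k) z =
        (Sum.map Sum.inr Sum.inr (Sum.elim Sum.inl k z) : (X ⊕ X) ⊕ (Empty ⊕ Z)) := by
        rintro (z | z) <;> simp
      rw [e2, e2, e]
  · intro hxy
    change (push (dmap X) α ⊔ push (umap X) ξ) (emap X x) (emap X y)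
    rw [cmap_def] at hxy
    rcases x with x | x <;> rcases y with y | y
    · simp at hxy
      exact mul_upper α ξ hxy
    · rcases hy : k y with m | z <;> simp [hy] at hxy
      have := mul_upper α ξ hxy
      exact Setoid.trans' _ this (Setoid.symm' _ (dn hy))
    · rcases hx : k x with m | z <;> simp [hx] at hxy
      have := mul_upper α ξ hxy
      exact Setoid.trans' _ (dn hx) this
    · rcases hx : k x with m | z <;> rcases hy : k y with m' | z' <;>
        simp [hx, hy] at hxy
      · have := mul_upper α ξ hxy
        exact Setoid.trans' _ (dn hx) (Setoid.trans' _ this (Setoid.symm' _ (dn hy)))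
      · have : ξ (Sum.inr x) (Sum.inr y) := by simp [hξ, Setoid.ker_def, hx, hy, hxy]
        exact mul_lower α ξ this

lemma cmap_con {X Z Z' : Type*} (σ : Con (PMon X)) (h : X → X ⊕ Z) (k : X → X ⊕ Z') {α β : PMon X}
    (hαβ : σ α β) : σ (cmap h k α) (cmap h k β) := by
  have e : ∀ α : PMon X, cmap h k α = ((Setoid.ker (Sum.elim h Sum.inl) : PMon X) * α) *
      (Setoid.ker (Sum.elim Sum.inl k) : PMon X) := by
    intro α
    rw [ker_mul, mul_ker]
    ext x y
    simp only [cmap_def]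
    rcases x with x | x <;> rcases y with y | y
    · rcases hx : h x with m | z <;> rcases hy : h y with m' | z' <;> simp [hx, hy, cmap_def]
    · rcases hx : h x with m | z <;> rcases hy : k y with m' | z' <;> simp [hx, hy, cmap_def]
    · rcases hx : k x with m | z <;> rcases hy : h y with m' | z' <;> simp [hx, hy, cmap_def]
    · rcases hx : k x with m | z <;> rcases hy : k y with m' | z' <;> simp [hx, hy, cmap_def]
  rw [e, e]
  exact σ.mul (σ.mul (σ.refl _) hαβ) (σ.refl _)

lemma upper_mul {X : Type*} (E : Setoid X) (α : PMon X) :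
    (Setoid.comap (Sum.elim id id) E : PMon X) * α = α ⊔ sumS E ⊥ := by
  set ξ : PMon X := Setoid.comap (Sum.elim id id) E with hξ
  have up : ∀ x : X, (push (dmap X) ξ ⊔ push (umap X) α)
      (Sum.inl x) (Sum.inr (Sum.inl x)) := fun x => by
    have : ξ (Sum.inl x) (Sum.inr x) := E.refl x
    simpa [dmap] using mul_upper ξ α this
  ext x y
  constructor
  · intro hxy
    have := mul_le (α ⊔ sumS E ⊥) Sum.inl Sum.inl Sum.inr ?_ ?_ hxy
    · rcases x with x | x <;> rcases y with y | y <;> simpa [cmap_def] using this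
    · intro x y hxy
      have : sumS E ⊥ ≤ α ⊔ sumS E (⊥ : Setoid X) := le_sup_right
      refine this ?_
      rcases x with x | x <;> rcases y with y | y <;> simpa using hxy
    · intro x y hxy
      have : α ≤ α ⊔ sumS E (⊥ : Setoid X) := le_sup_left
      refine this ?_
      rcases x with x | x <;> rcases y with y | y <;> simpa using hxy
  · intro hxy
    have : α ⊔ sumS E ⊥ ≤ ξ * α := by
      refine sup_le ?_ ?_
      · intro x y hxy
        have h1 := mul_lower ξ α hxy
        change (push (dmap X) ξ ⊔ push (umap X) α) (emap X x) (emap X y)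
        have h2 : ∀ x, (push (dmap X) ξ ⊔ push (umap X) α) (emap X x) (umap X x) := by
          rintro (x | x)
          · exact up x
          · exact Setoid.refl' _ _
        exact Setoid.trans' _ (h2 x) (Setoid.trans' _ h1 (Setoid.symm' _ (h2 y)))
      · intro x y hxy
        rcases x with x | x <;> rcases y with y | y <;> simp at hxy
        · have : ξ (Sum.inl x) (Sum.inl y) := hxy
          exact mul_upper ξ α this
        · rw [hxy]
    exact this hxy

lemma mul_under {X : Type*} (E : Setoid X) (α : PMon X) :
    α * (Setoid.comap (Sum.elim id id) E : PMon X) = α ⊔ sumS ⊥ E := by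
  set ξ : PMon X := Setoid.comap (Sum.elim id id) E with hξ
  have dn : ∀ x : X, (push (dmap X) α ⊔ push (umap X) ξ)
      (Sum.inr (Sum.inr x)) (Sum.inr (Sum.inl x)) := fun x => by
    have : ξ (Sum.inr x) (Sum.inl x) := E.refl x
    simpa [umap] using mul_lower α ξ this
  ext x y
  constructor
  · intro hxy
    have := mul_le (α ⊔ sumS ⊥ E) Sum.inl Sum.inr Sum.inr ?_ ?_ hxy
    · rcases x with x | x <;> rcases y with y | y <;> simpa [cmap_def] using this
    · intro x y hxy
      have : α ≤ α ⊔ sumS (⊥ : Setoid X) E := le_sup_left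
      refine this ?_
      rcases x with x | x <;> rcases y with y | y <;> simpa using hxy
    · intro x y hxy
      have : sumS ⊥ E ≤ α ⊔ sumS (⊥ : Setoid X) E := le_sup_right
      refine this ?_
      rcases x with x | x <;> rcases y with y | y <;> simpa using hxy
  · intro hxy
    have : α ⊔ sumS ⊥ E ≤ α * ξ := by
      refine sup_le ?_ ?_
      · intro x y hxy
        have h1 := mul_upper α ξ hxy
        change (push (dmap X) α ⊔ push (umap X) ξ) (emap X x) (emap X y)
        have h2 : ∀ x, (push (dmap X) α ⊔ push (umap X) ξ) (emap X x) (dmap X x) := by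
          rintro (x | x)
          · exact Setoid.refl' _ _
          · exact dn x
        exact Setoid.trans' _ (h2 x) (Setoid.trans' _ h1 (Setoid.symm' _ (h2 y)))
      · intro x y hxy
        rcases x with x | x <;> rcases y with y | y <;> simp at hxy
        · rw [hxy]
        · have : ξ (Sum.inr x) (Sum.inr y) := hxy
          exact mul_lower α ξ this
    exact this hxy

lemma sumS_sup {A B : Type*} (E : Setoid A) (F : Setoid B) :
    sumS E F = sumS E ⊥ ⊔ sumS ⊥ F := by
  apply le_antisymm
  · rintro (x | x) (y | y) h <;> simp at h
    · exact (le_sup_left : sumS E ⊥ ≤ sumS E ⊥ ⊔ sumS ⊥ F) (by simpa using h)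
    · exact (le_sup_right : sumS ⊥ F ≤ sumS E ⊥ ⊔ sumS ⊥ F) (by simpa using h)
  · refine sup_le ?_ ?_
    · rintro (x | x) (y | y) h <;> simp at h ⊢
      · exact h
      · rw [h]
    · rintro (x | x) (y | y) h <;> simp at h ⊢
      · rw [h]
      · exact h

lemma join_con {X : Type*} (σ : Con (PMon X)) (E F : Setoid X) {α β : PMon X}
    (hαβ : σ α β) : σ (α ⊔ sumS E F) (β ⊔ sumS E F) := by
  rw [sumS_sup, ← sup_assoc, ← sup_assoc, ← upper_mul, ← upper_mul, ← mul_under, ← mul_under]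
  exact σ.mul (σ.mul (σ.refl _) hαβ) (σ.refl _)

/-- Composition of relabellings. -/
def hcomp {P P' P'' Z Z' : Type*} (h' : P'' → P' ⊕ Z') (h : P' → P ⊕ Z) : P'' → P ⊕ (Z ⊕ Z') :=
  fun x => (h' x).elim (fun m => (h m).elim Sum.inl (Sum.inr ∘ Sum.inl)) (Sum.inr ∘ Sum.inr)

lemma cmap_cmap {P P' P'' Q Q' Q'' Z Z' W W' : Type*} (h' : P'' → P' ⊕ Z') (h : P' → P ⊕ Z)
    (k' : Q'' → Q' ⊕ W') (k : Q' → Q ⊕ W) (ω : Setoid (P ⊕ Q)) :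
    cmap h' k' (cmap h k ω) = cmap (hcomp h' h) (hcomp k' k) ω := by
  ext x y
  simp only [cmap_def]
  rcases x with x | x <;> rcases y with y | y
  · rcases hx : h' x with m | z <;> rcases hy : h' y with m' | z'
    · rcases hm : h m with p | z <;> rcases hm' : h m' with p' | z' <;>
        simp [hcomp, hx, hy, hm, hm', cmap_def]
    · rcases hm : h m with p | z <;> simp [hcomp, hx, hy, hm, cmap_def]
    · rcases hm' : h m' with p | z <;> simp [hcomp, hx, hy, hm', cmap_def]
    · simp [hcomp, hx, hy, cmap_def]
  · rcases hx : h' x with m | z <;> rcases hy : k' y with m' | z'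
    · rcases hm : h m with p | z <;> rcases hm' : k m' with p' | z' <;>
        simp [hcomp, hx, hy, hm, hm', cmap_def]
    · rcases hm : h m with p | z <;> simp [hcomp, hx, hy, hm, cmap_def]
    · rcases hm' : k m' with p | z <;> simp [hcomp, hx, hy, hm', cmap_def]
    · simp [hcomp, hx, hy, cmap_def]
  · rcases hx : k' x with m | z <;> rcases hy : h' y with m' | z'
    · rcases hm : k m with p | z <;> rcases hm' : h m' with p' | z' <;>
        simp [hcomp, hx, hy, hm, hm', cmap_def]
    · rcases hm : k m with p | z <;> simp [hcomp, hx, hy, hm, cmap_def]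
    · rcases hm' : h m' with p | z <;> simp [hcomp, hx, hy, hm', cmap_def]
    · simp [hcomp, hx, hy, cmap_def]
  · rcases hx : k' x with m | z <;> rcases hy : k' y with m' | z'
    · rcases hm : k m with p | z <;> rcases hm' : k m' with p' | z' <;>
        simp [hcomp, hx, hy, hm, hm', cmap_def]
    · rcases hm : k m with p | z <;> simp [hcomp, hx, hy, hm, cmap_def]
    · rcases hm' : k m' with p | z <;> simp [hcomp, hx, hy, hm', cmap_def]
    · simp [hcomp, hx, hy, cmap_def]

/-- A family of equivalence relations on partitions with arbitrary sets of upper and lower points,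
stable under relabelling and under joining with small partitions of the upper and lower points. -/
structure Sys (X : Type u) where
  /-- the relation -/
  rel : ∀ {P Q : Type u}, Setoid (P ⊕ Q) → Setoid (P ⊕ Q) → Prop
  refl : ∀ {P Q : Type u} (ω : Setoid (P ⊕ Q)), rel ω ω
  symm : ∀ {P Q : Type u} {ω ω' : Setoid (P ⊕ Q)}, rel ω ω' → rel ω' ω
  trans : ∀ {P Q : Type u} {ω ω' ω'' : Setoid (P ⊕ Q)}, rel ω ω' → rel ω' ω'' → rel ω ω''
  cmap : ∀ {P Q P' Q' Z Z' : Type u} {ω ω' : Setoid (P ⊕ Q)} (h : P' → P ⊕ Z) (k : Q' → Q ⊕ Z'),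
    rel ω ω' → rel (cmap h k ω) (cmap h k ω')
  join : ∀ {P Q : Type u} {ω ω' : Setoid (P ⊕ Q)} (E : Setoid P) (F : Setoid Q), #P ≤ #X →
    #Q ≤ #X → rel ω ω' → rel (ω ⊔ sumS E F) (ω' ⊔ sumS E F)

lemma sup_rel_of {A B : Type*} {r s : Setoid A} (τ : Setoid B) (f : A → B)
    (hr : ∀ x y, r x y → τ (f x) (f y)) (hs : ∀ x y, s x y → τ (f x) (f y)) {x y : A}
    (h : (r ⊔ s) x y) : τ (f x) (f y) := by
  have : r ⊔ s ≤ Setoid.comap f τ := sup_le (fun {x y} => hr x y) (fun {x y} => hs x y)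
  exact this h

lemma sup_rel_left {A : Type*} {r s : Setoid A} {x y : A} (h : r x y) : (r ⊔ s) x y :=
  (le_sup_left : r ≤ r ⊔ s) h

lemma sup_rel_right {A : Type*} {r s : Setoid A} {x y : A} (h : s x y) : (r ⊔ s) x y :=
  (le_sup_right : s ≤ r ⊔ s) h

lemma sup_sumS_eq_cmap {P Q P' Q' : Type*} (φ : P' ≃ P ⊕ P') (ψ : Q' ≃ Q ⊕ Q')
    (ω : Setoid (P ⊕ Q)) (E : Setoid P) (F : Setoid Q) :
    ω ⊔ sumS E F = cmap (fun p => (Sum.inl (φ.symm (Sum.inl p)) : P' ⊕ PEmpty.{1}))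
      (fun q => (Sum.inl (ψ.symm (Sum.inl q)) : Q' ⊕ PEmpty.{1}))
      (cmap φ ψ ω ⊔ sumS (Setoid.comap φ (sumS E ⊥)) (Setoid.comap ψ (sumS F ⊥))) := by
  have eq : ∀ ω : Setoid (P' ⊕ Q'), cmap (fun p => (Sum.inl (φ.symm (Sum.inl p)) : P' ⊕ PEmpty.{1}))
      (fun q => (Sum.inl (ψ.symm (Sum.inl q)) : Q' ⊕ PEmpty.{1})) ω =
      Setoid.comap (Sum.map (fun p => φ.symm (Sum.inl p)) (fun q => ψ.symm (Sum.inl q))) ω := by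
    intro ω
    ext x y
    rcases x with x | x <;> rcases y with y | y <;> simp [cmap_def]
  rw [eq]
  ext x y
  constructor
  · refine sup_rel_of (_ ⊔ _) (Sum.map (fun p => φ.symm (Sum.inl p)) (fun q => ψ.symm (Sum.inl q)))
      ?_ ?_
    · intro x y h
      refine sup_rel_left ?_
      rcases x with x | x <;> rcases y with y | y <;> simpa [cmap_def] using h
    · intro x y h
      refine sup_rel_right ?_
      rcases x with x | x <;> rcases y with y | y <;> simpa [cmap_def] using h
  · intro h
    have := sup_rel_of (sumS (ω ⊔ sumS E F) (⊥ : Setoid (P' ⊕ Q')))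
      (Sum.elim (Sum.map Sum.inl Sum.inl ∘ φ) (Sum.map Sum.inr Sum.inr ∘ ψ)) ?_ ?_ h
    · rcases x with x | x <;> rcases y with y | y <;> simpa using this
    · intro x y h
      rw [cmap_def] at h
      revert h
      generalize Sum.elim (Sum.map Sum.inl Sum.inl ∘ φ) (Sum.map Sum.inr Sum.inr ∘ ψ) x = x'
      generalize Sum.elim (Sum.map Sum.inl Sum.inl ∘ φ) (Sum.map Sum.inr Sum.inr ∘ ψ) y = y'
      intro h
      rcases x' with x | x <;> rcases y' with y | y
      · simp at h ⊢
        exact sup_rel_left h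
      · simp at h
      · simp at h
      · simpa using h
    · intro x y h
      have hl : ∀ {x y}, E x y → (ω ⊔ sumS E F) (Sum.inl x) (Sum.inl y) := fun h =>
        sup_rel_right (by simpa using h)
      have hr : ∀ {x y}, F x y → (ω ⊔ sumS E F) (Sum.inr x) (Sum.inr y) := fun h =>
        sup_rel_right (by simpa using h)
      rcases x with x | x <;> rcases y with y | y
      · rcases hx : φ x with x' | x' <;> rcases hy : φ y with y' | y' <;> simp [hx, hy] at h ⊢
        · exact hl h
        · exact h
      · simp at h
      · simp at h
      · rcases hx : ψ x with x' | x' <;> rcases hy : ψ y with y' | y' <;> simp [hx, hy] at h ⊢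
        · exact hr h
        · exact h

lemma exists_equiv_sum {X : Type u} [Infinite X] {P : Type u} (h : #P ≤ #X) :
    Nonempty (X ≃ P ⊕ X) := by
  rw [← Cardinal.eq]
  simp [Cardinal.add_eq_right (Cardinal.aleph0_le_mk X) h]

/-- The system of relations attached to a congruence. -/
def ofCon {X : Type u} [Infinite X] (σ : Con (PMon X)) : Sys X where
  rel {P Q} ω ω' := ∀ (Z Z' : Type u) (h : X → P ⊕ Z) (k : X → Q ⊕ Z'),
    σ (cmap h k ω) (cmap h k ω')
  refl ω Z Z' h k := σ.refl _
  symm H Z Z' h k := σ.symm (H Z Z' h k)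
  trans H H' Z Z' h k := σ.trans (H Z Z' h k) (H' Z Z' h k)
  cmap h' k' H Z Z' h k := by
    rw [cmap_cmap, cmap_cmap]
    exact H _ _ _ _
  join E F hP hQ H Z Z' h k := by
    obtain ⟨φ⟩ := exists_equiv_sum hP
    obtain ⟨ψ⟩ := exists_equiv_sum hQ
    rw [sup_sumS_eq_cmap φ ψ, sup_sumS_eq_cmap φ ψ, cmap_cmap, cmap_cmap]
    exact cmap_con σ _ _ (join_con σ _ _ (H _ _ φ ψ))

lemma ofCon_rel {X : Type u} [Infinite X] {σ : Con (PMon X)} {α β : PMon X} :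
    (ofCon σ).rel α β ↔ σ α β := by
  constructor
  · intro h
    have e : ∀ α : PMon X, cmap (Sum.inl : X → X ⊕ X) (Sum.inl : X → X ⊕ X) α = α := by
      intro α
      ext x y
      rcases x with x | x <;> rcases y with y | y <;> simp [cmap_def]
    have := h X X Sum.inl Sum.inl
    rwa [e, e] at this
  · intro h Z Z' f k
    exact cmap_con σ f k h

namespace Sys
variable {X : Type u} (S : Sys X)

/-- Interchanging upper and lower points. -/
def dual : Sys X where
  rel ω ω' := S.rel (Setoid.comap Sum.swap ω) (Setoid.comap Sum.swap ω')
  refl ω := S.refl _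
  symm H := S.symm H
  trans H H' := S.trans H H'
  cmap {P Q P' Q' Z Z' ω ω'} h k H := by
    have e : ∀ ω : Setoid (P ⊕ Q), Setoid.comap Sum.swap (PartitionCongruences.cmap h k ω) =
        PartitionCongruences.cmap k h (Setoid.comap Sum.swap ω) := by
      intro ω
      ext x y
      rcases x with x | x <;> rcases y with y | y
      · rcases hx : k x <;> rcases hy : k y <;> simp [cmap_def, hx, hy]
      · rcases hx : k x <;> rcases hy : h y <;> simp [cmap_def, hx, hy]
      · rcases hx : h x <;> rcases hy : k y <;> simp [cmap_def, hx, hy]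
      · rcases hx : h x <;> rcases hy : h y <;> simp [cmap_def, hx, hy]
    rw [e, e]
    exact S.cmap k h H
  join {P Q ω ω'} E F hP hQ H := by
    have e : ∀ ω : Setoid (P ⊕ Q), Setoid.comap Sum.swap (ω ⊔ sumS E F) =
        Setoid.comap Sum.swap ω ⊔ sumS F E := by
      intro ω
      ext x y
      constructor
      · intro h
        have := sup_rel_of (Setoid.comap Sum.swap ω ⊔ sumS F E) Sum.swap ?_ ?_ h
        · simpa using this
        · intro x y h
          exact sup_rel_left (by simpa using h)
        · intro x y h
          refine sup_rel_right ?_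
          rcases x with x | x <;> rcases y with y | y <;> simp at h ⊢ <;> exact h
      · refine sup_rel_of (ω ⊔ sumS E F) Sum.swap ?_ ?_
        · intro x y h
          exact sup_rel_left (by simpa using h)
        · intro x y h
          refine sup_rel_right ?_
          rcases x with x | x <;> rcases y with y | y <;> simp at h ⊢ <;> exact h
    rw [e, e]
    exact S.join F E hQ hP H

end Sys

/-- A partition extended by transversals indexed by `J`. -/
def ext (J : Type u) {P Q : Type u} (ω : Setoid (P ⊕ Q)) : Setoid ((J ⊕ P) ⊕ (J ⊕ Q)) :=
  Setoid.comap (Sum.elim (Sum.map id Sum.inl) (Sum.map id Sum.inr)) (sumS (⊥ : Setoid J) ω)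

lemma ext_def (J : Type u) {P Q : Type u} (ω : Setoid (P ⊕ Q)) (x y : (J ⊕ P) ⊕ (J ⊕ Q)) :
    ext J ω x y ↔ sumS (⊥ : Setoid J) ω (Sum.elim (Sum.map id Sum.inl) (Sum.map id Sum.inr) x)
      (Sum.elim (Sum.map id Sum.inl) (Sum.map id Sum.inr) y) := Iff.rfl

lemma ext_cmap (J : Type u) {P P' Q Q' Z Z' : Type u} (h : P' → P ⊕ Z) (k : Q' → Q ⊕ Z')
    (ω : Setoid (P ⊕ Q)) : ext J (cmap h k ω) =
      cmap (fun x => x.elim (fun j => Sum.inl (Sum.inl j)) (fun p => Sum.map Sum.inr id (h p)))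
        (fun x => x.elim (fun j => Sum.inl (Sum.inl j)) (fun p => Sum.map Sum.inr id (k p)))
        (ext J ω) := by
  ext x y
  rcases x with (x | x) | (x | x) <;> rcases y with (y | y) | (y | y)
  · simp [cmap_def, ext_def, *]
  · rcases hy : h y <;> simp [cmap_def, ext_def, *]
  · simp [cmap_def, ext_def, *]
  · rcases hy : k y <;> simp [cmap_def, ext_def, *]
  · rcases hx : h x <;> simp [cmap_def, ext_def, *]
  · rcases hx : h x <;> rcases hy : h y <;> simp [cmap_def, ext_def, *]
  · rcases hx : h x <;> simp [cmap_def, ext_def, *]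
  · rcases hx : h x <;> rcases hy : k y <;> simp [cmap_def, ext_def, *]
  · simp [cmap_def, ext_def, *]
  · rcases hy : h y <;> simp [cmap_def, ext_def, *]
  · simp [cmap_def, ext_def, *]
  · rcases hy : k y <;> simp [cmap_def, ext_def, *]
  · rcases hx : k x <;> simp [cmap_def, ext_def, *]
  · rcases hx : k x <;> rcases hy : h y <;> simp [cmap_def, ext_def, *]
  · rcases hx : k x <;> simp [cmap_def, ext_def, *]
  · rcases hx : k x <;> rcases hy : k y <;> simp [cmap_def, ext_def, *]

lemma ext_sup (J : Type u) {P Q : Type u} (E : Setoid P) (F : Setoid Q) (ω : Setoid (P ⊕ Q)) :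
    ext J (ω ⊔ sumS E F) = ext J ω ⊔ sumS (sumS ⊥ E) (sumS ⊥ F) := by
  ext x y
  constructor
  · have key : ∀ {x y}, (ω ⊔ sumS E F) x y → (ext J ω ⊔ sumS (sumS ⊥ E) (sumS ⊥ F))
        (Sum.map Sum.inr Sum.inr x) (Sum.map Sum.inr Sum.inr y) := by
      refine sup_rel_of _ _ ?_ ?_
      · intro x y h
        refine sup_rel_left ?_
        rcases x with x | x <;> rcases y with y | y <;> simpa [ext_def] using h
      · intro x y h
        refine sup_rel_right ?_
        rcases x with x | x <;> rcases y with y | y <;> simpa using h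
    intro h
    rcases x with (x | x) | (x | x) <;> rcases y with (y | y) | (y | y) <;> simp [ext_def] at h
    any_goals exact key h
    all_goals exact sup_rel_left (by simpa [ext_def] using h)
  · intro h
    refine sup_rel_of _ id ?_ ?_ h
    · intro x y h
      rcases x with (x | x) | (x | x) <;> rcases y with (y | y) | (y | y) <;>
        simp [ext_def] at h ⊢
      any_goals exact sup_rel_left h
      all_goals exact h
    · intro x y h
      rcases x with (x | x) | (x | x) <;> rcases y with (y | y) | (y | y) <;>
        simp [ext_def] at h ⊢
      any_goals exact sup_rel_right (by simpa using h)
      all_goals exact h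

namespace Sys
variable {X : Type u} (S : Sys X)

/-- The system obtained by adding transversals indexed by a small type `J`. -/
def shift [Infinite X] (J : Type u) (hJ : #J ≤ #X) : Sys X where
  rel ω ω' := S.rel (ext J ω) (ext J ω')
  refl ω := S.refl _
  symm H := S.symm H
  trans H H' := S.trans H H'
  cmap h k H := by
    rw [ext_cmap, ext_cmap]
    exact S.cmap _ _ H
  join {P Q ω ω'} E F hP hQ H := by
    rw [ext_sup, ext_sup]
    refine S.join _ _ ?_ ?_ H
    · rw [← Cardinal.add_def]; exact Cardinal.add_le_of_le (Cardinal.aleph0_le_mk X) hJ hP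
    · rw [← Cardinal.add_def]; exact Cardinal.add_le_of_le (Cardinal.aleph0_le_mk X) hJ hQ

lemma comap {P Q P' Q' : Type u} {ω ω' : Setoid (P ⊕ Q)} (a : P' → P) (b : Q' → Q)
    (H : S.rel ω ω') : S.rel (Setoid.comap (Sum.map a b) ω) (Setoid.comap (Sum.map a b) ω') := by
  have e : ∀ ω : Setoid (P ⊕ Q), Setoid.comap (Sum.map a b) ω =
      PartitionCongruences.cmap (fun p => (Sum.inl (a p) : P ⊕ P))
        (fun q => (Sum.inl (b q) : Q ⊕ Q)) ω := by
    intro ω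
    ext x y
    rcases x with x | x <;> rcases y with y | y <;> simp [cmap_def]
  rw [e, e]
  exact S.cmap _ _ H

end Sys

/-! ### Combinatorial lemmas -/

lemma exists_cross {Y : Type*} (r : Setoid Y) : ∃ A : Set Y,
    (∀ a ∈ A, ∀ b ∈ A, r a b → a = b) ∧ ∀ y, ∃ a ∈ A, r y a := by
  refine ⟨Set.range (fun q : Quotient r => q.out), ?_, ?_⟩
  · rintro _ ⟨a, rfl⟩ _ ⟨b, rfl⟩ h
    have : a = b := by
      rw [← Quotient.out_eq a, ← Quotient.out_eq b]
      exact Quotient.sound h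
    rw [this]
  · intro y
    exact ⟨_, ⟨Quotient.mk r y, rfl⟩, Setoid.symm' r (Quotient.mk_out y)⟩

lemma pigeonhole_or {I : Type u} [Infinite I] {p q : I → Prop} (h : ∀ i, p i ∨ q i) :
    #{i // p i} = #I ∨ #{i // q i} = #I := by
  by_contra hc
  push Not at hc
  have hp := lt_of_le_of_ne (Cardinal.mk_subtype_le p) hc.1
  have hq := lt_of_le_of_ne (Cardinal.mk_subtype_le q) hc.2
  have h1 : #I ≤ #{i // p i} + #{i // q i} := by
    rw [← Cardinal.mk_univ]
    calc #(Set.univ : Set I) ≤ #({i | p i} ∪ {i | q i} : Set I) :=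
          Cardinal.mk_le_mk_of_subset (fun i _ => h i)
      _ ≤ _ := Cardinal.mk_union_le _ _
  exact absurd h1 (not_le.2 (Cardinal.add_lt_of_lt (Cardinal.aleph0_le_mk I) hp hq))

lemma exists_free {I : Type u} [Infinite I] (r : I → I → Prop)
    (hf : ∀ i j k, r i j → r i k → j = k) (hi : ∀ i, ¬ r i i) :
    ∃ s : Set I, #s = #I ∧ ∀ i ∈ s, ∀ j ∈ s, ¬ r i j := by
  obtain ⟨s, hs⟩ := zorn_subset {s : Set I | ∀ i ∈ s, ∀ j ∈ s, ¬ r i j} (by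
    intro c hc hch
    refine ⟨⋃₀ c, ?_, fun t ht => Set.subset_sUnion_of_mem ht⟩
    rintro i ⟨t, ht, hit⟩ j ⟨t', ht', hjt⟩
    rcases hch.total ht ht' with h | h
    · exact hc ht' i (h hit) j hjt
    · exact hc ht i hit j (h hjt))
  by_cases hcard : #s = #I
  · exact ⟨s, hcard, hs.prop⟩
  have hlt : #s < #I := lt_of_le_of_ne (Cardinal.mk_set_le s) hcard
  refine ⟨{i | i ∉ s ∧ ∃ k ∈ s, r i k}, ?_, ?_⟩
  · let v : Set I := {i | ∃ k ∈ s, r k i}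
    have hv : #v ≤ #s := by
      refine Cardinal.mk_le_of_injective (f := fun x : v => (⟨x.2.choose, x.2.choose_spec.1⟩ : s)) ?_
      intro x y hxy
      have e : x.2.choose = y.2.choose := congrArg Subtype.val hxy
      have h1 := x.2.choose_spec.2
      rw [e] at h1
      exact Subtype.ext (hf _ _ _ h1 y.2.choose_spec.2)
    have hcov : ∀ i, (i ∈ s ∪ v) ∨ (i ∉ s ∧ ∃ k ∈ s, r i k) := by
      intro i
      by_contra hc
      push Not at hc
      obtain ⟨h1, h2⟩ := hc
      simp only [Set.mem_union, not_or] at h1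
      have : insert i s ∈ {s : Set I | ∀ i ∈ s, ∀ j ∈ s, ¬ r i j} := by
        rintro a (rfl | ha) b (rfl | hb)
        · exact hi _
        · exact h2 h1.1 b hb
        · exact fun hr => h1.2 ⟨a, ha, hr⟩
        · exact hs.prop a ha b hb
      exact h1.1 (hs.le_of_ge this (Set.subset_insert i s) (Set.mem_insert i s))
    rcases pigeonhole_or hcov with h | h
    · exfalso
      have : #(s ∪ v : Set I) < #I :=
        lt_of_le_of_lt (Cardinal.mk_union_le _ _)
          (Cardinal.add_lt_of_lt (Cardinal.aleph0_le_mk I) hlt (hv.trans_lt hlt))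
      exact this.ne h
    · exact h
  · rintro i ⟨_, k, hk, hik⟩ j ⟨hj, _⟩ hij
    rw [hf _ _ _ hij hik] at hj
    exact hj hk

/-! ### Collapsing transversals -/

/-- The partition with the transversals `{i, i'}`. -/
def eT (I : Type*) : Setoid (I ⊕ I) := Setoid.comap (Sum.elim id id) ⊥

@[simp] lemma eT_rel {I : Type*} (x y : I ⊕ I) :
    eT I x y ↔ Sum.elim id id x = Sum.elim id id y := Iff.rfl

namespace Sys
variable {X : Type u} (S : Sys X)

/-- The transversals indexed by `I` may be split. -/
def Col (I : Type u) : Prop := S.rel (eT I) ⊥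

variable {S}

lemma comap_eT {I M : Type u} {f : M → I} (hf : f.Injective) :
    Setoid.comap (Sum.map f f) (eT I) = eT M := by
  ext x y
  rcases x with x | x <;> rcases y with y | y <;> simp [hf.eq_iff]

lemma comap_bot {P Q P' Q' : Type u} {f : P' → P} {g : Q' → Q} (hf : f.Injective)
    (hg : g.Injective) : Setoid.comap (Sum.map f g) ⊥ = (⊥ : Setoid (P' ⊕ Q')) := by
  ext x y
  rcases x with x | x <;> rcases y with y | y <;> simp [hf.eq_iff, hg.eq_iff]

lemma Col.mono {I M : Type u} {f : M → I} (hf : f.Injective) (h : S.Col I) : S.Col M := by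
  have := S.comap f f h
  rwa [comap_eT hf, comap_bot hf hf] at this

lemma Col.of_le {I M : Type u} (hf : #M ≤ #I) (h : S.Col I) : S.Col M := by
  obtain ⟨f⟩ := hf
  exact h.mono f.injective

lemma col_dual {I : Type u} : S.dual.Col I ↔ S.Col I := by
  have e1 : Setoid.comap Sum.swap (eT I) = eT I := by
    ext x y
    rcases x with x | x <;> rcases y with y | y <;> simp
  have e2 : Setoid.comap Sum.swap ⊥ = (⊥ : Setoid (I ⊕ I)) := by
    ext x y
    rcases x with x | x <;> rcases y with y | y <;> simp
  change S.rel _ _ ↔ S.rel _ _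
  rw [e1, e2]

lemma dual_eT {I : Type u} {ω : Setoid (I ⊕ I)} (H : S.rel (eT I) ω) :
    S.dual.rel (eT I) (Setoid.comap Sum.swap ω) := by
  have e1 : Setoid.comap Sum.swap (eT I) = eT I := by
    ext x y
    rcases x with x | x <;> rcases y with y | y <;> simp
  have e2 : Setoid.comap Sum.swap (Setoid.comap Sum.swap ω) = ω := by
    ext x y
    simp
  change S.rel _ _
  rwa [e1, e2]

lemma col_of_split {I : Type u} (hI : #I ≤ #X) {ω : Setoid (I ⊕ I)} (H : S.rel (eT I) ω)
    (hω : ∀ i j, ¬ ω (Sum.inl i) (Sum.inr j)) : S.Col I := by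
  set K := Setoid.comap Sum.inl ω with hK
  set L := Setoid.comap Sum.inr ω with hL
  have hω' : ∀ i j, ¬ ω (Sum.inr i) (Sum.inl j) := fun i j h => hω j i (ω.symm h)
  have h1 : S.rel ⊥ (sumS K (⊥ : Setoid I)) := by
    have := S.cmap (Sum.inl : I → I ⊕ I) (Sum.inr : I → I ⊕ I) H
    convert this using 1 <;> ext x y <;> rcases x with x | x <;> rcases y with y | y <;>
      simp [cmap_def, hK]
  have h2 : S.rel ⊥ (sumS (⊥ : Setoid I) L) := by
    have := S.cmap (Sum.inr : I → I ⊕ I) (Sum.inl : I → I ⊕ I) H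
    convert this using 1 <;> ext x y <;> rcases x with x | x <;> rcases y with y | y <;>
      simp [cmap_def, hL]
  have h3 := S.join ⊥ L hI hI h1
  rw [bot_sup_eq, ← sumS_sup] at h3
  have e : sumS K L = ω := by
    ext x y
    rcases x with x | x <;> rcases y with y | y <;> simp [hK, hL, hω, hω']
  rw [e] at h3
  exact S.trans H (S.symm (S.trans h2 h3))

lemma col_of_merge {I : Type u} (hI : #I ≤ #X) {ω : Setoid (I ⊕ I)} (H : S.rel (eT I) ω)
    (A : Set I) (hA : ∀ i, ∃ a ∈ A, ω (Sum.inl i) (Sum.inl a)) : S.Col {i // i ∉ A} := by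
  choose ρ hρ hω using hA
  have h1 := S.comap (fun m : {i // i ∉ A} => m.1) (fun m : {i // i ∉ A} => m.1) H
  have h2 := S.comap (fun m : {i // i ∉ A} => ρ m.1) (fun m : {i // i ∉ A} => m.1) H
  rw [comap_eT Subtype.val_injective] at h1
  have e : Setoid.comap (Sum.map (fun m : {i // i ∉ A} => ρ m.1) (fun m : {i // i ∉ A} => m.1)) ω =
      Setoid.comap (Sum.map (fun m : {i // i ∉ A} => m.1) (fun m : {i // i ∉ A} => m.1)) ω := by
    refine Setoid.ext fun x y => ?_
    have key : ∀ x : {i // i ∉ A} ⊕ {i // i ∉ A}, ω (Sum.map (fun m => m.1) (fun m => m.1) x)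
        (Sum.map (fun m => ρ m.1) (fun m => m.1) x) := by
      rintro (x | x)
      · exact hω _
      · exact ω.refl _
    exact ⟨fun h => ω.trans (key x) (ω.trans h (ω.symm (key y))),
      fun h => ω.trans (ω.symm (key x)) (ω.trans h (key y))⟩
  rw [e] at h2
  refine col_of_split ((Cardinal.mk_subtype_le _).trans hI) (S.trans h1 (S.symm h2)) ?_
  intro i j h
  have : ρ i = j := by simpa using h
  exact j.2 (this ▸ hρ i)

lemma col_of_distinct {I : Type u} [Infinite I] (hI : #I ≤ #X) {ω : Setoid (I ⊕ I)}
    (H : S.rel (eT I) ω) (hω : ∀ i, ¬ ω (Sum.inl i) (Sum.inr i))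
    (hb : ∀ i j, ω (Sum.inr i) (Sum.inr j) → i = j) : S.Col I := by
  obtain ⟨s, hs, hfree⟩ := exists_free (fun i j => ω (Sum.inl i) (Sum.inr j))
    (fun i j k h h' => hb j k (ω.trans (ω.symm h) h')) hω
  refine Col.of_le hs.ge (I := s) ?_
  have h1 := S.comap (fun m : s => m.1) (fun m : s => m.1) H
  rw [comap_eT Subtype.val_injective] at h1
  refine col_of_split ((Cardinal.mk_set_le s).trans hI) h1 ?_
  intro i j
  exact hfree i i.2 j j.2

lemma col_of_irrefl {I : Type u} [Infinite I] (hI : #I ≤ #X) {ω : Setoid (I ⊕ I)}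
    (H : S.rel (eT I) ω) (hω : ∀ i, ¬ ω (Sum.inl i) (Sum.inr i)) : S.Col I := by
  obtain ⟨A, hA, hA'⟩ := exists_cross (Setoid.comap Sum.inr ω)
  rcases pigeonhole_or (fun i => em (i ∈ A)) with h | h
  · refine Col.of_le h.ge ?_
    have h1 := S.comap (fun m : {i // i ∈ A} => m.1) (fun m : {i // i ∈ A} => m.1) H
    rw [comap_eT Subtype.val_injective] at h1
    have : Infinite {i // i ∈ A} := by
      rw [Cardinal.infinite_iff, h]; exact Cardinal.aleph0_le_mk I
    refine col_of_distinct ((Cardinal.mk_subtype_le _).trans hI) h1 (fun i => hω i) ?_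
    intro i j hij
    exact Subtype.ext (hA i i.2 j j.2 hij)
  · refine Col.of_le h.ge (col_dual.1 ?_)
    exact col_of_merge hI (dual_eT H) A (fun i => hA' i)

lemma col_of_irrefl' {I : Type u} (hI' : Infinite I ∨ Subsingleton I) (hI : #I ≤ #X)
    {ω : Setoid (I ⊕ I)} (H : S.rel (eT I) ω) (hω : ∀ i, ¬ ω (Sum.inl i) (Sum.inr i)) :
    S.Col I := by
  rcases hI' with h | h
  · exact col_of_irrefl hI H hω
  · refine col_of_split hI H fun i j => ?_
    rw [Subsingleton.elim j i]
    exact hω i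

lemma eq_eT {P Q I : Type u} {ω : Setoid (P ⊕ Q)} {a : I → P} {b : I → Q}
    (h : ∀ i j, ω (Sum.inl (a i)) (Sum.inr (b j)) ↔ i = j) :
    Setoid.comap (Sum.map a b) ω = eT I := by
  ext x y
  rcases x with x | x <;> rcases y with y | y <;> simp
  · refine ⟨fun h' => ?_, fun h' => h' ▸ ω.refl _⟩
    exact (h x y).1 (ω.trans h' ((h y y).2 rfl))
  · exact h x y
  · rw [eq_comm, ← h y x]
    exact ⟨ω.symm, ω.symm⟩
  · refine ⟨fun h' => ?_, fun h' => h' ▸ ω.refl _⟩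
    exact (h x y).1 (ω.trans ((h x x).2 rfl) h')

section
variable {P Q I : Type u} {α β : Setoid (P ⊕ Q)}

lemma col_of_broken (hI' : Infinite I ∨ Subsingleton I) (hI : #I ≤ #X) (H : S.rel α β)
    {a : I → P} {b : I → Q}
    (h : ∀ i j, α (Sum.inl (a i)) (Sum.inr (b j)) ↔ i = j)
    (hβ : ∀ i, ¬ β (Sum.inl (a i)) (Sum.inr (b i))) : S.Col I := by
  have h1 := S.comap a b H
  rw [eq_eT h] at h1
  exact col_of_irrefl' hI' hI h1 hβ

lemma comap_congr {P' : Type u} {ω : Setoid (P ⊕ Q)} {a a' : P' → P} {b b' : I → Q}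
    (h : ∀ i, ω (Sum.inl (a i)) (Sum.inl (a' i))) (h' : ∀ i, ω (Sum.inr (b i)) (Sum.inr (b' i))) :
    Setoid.comap (Sum.map a b) ω = Setoid.comap (Sum.map a' b') ω := by
  refine Setoid.ext fun x y => ?_
  have key : ∀ x : P' ⊕ I, ω (Sum.map a b x) (Sum.map a' b' x) := by
    rintro (x | x)
    · exact h _
    · exact h' _
  exact ⟨fun h => ω.trans (ω.symm (key x)) (ω.trans h (key y)),
    fun h => ω.trans (key x) (ω.trans h (ω.symm (key y)))⟩

lemma col_of_moved (hI' : Infinite I ∨ Subsingleton I) (hI : #I ≤ #X) (H : S.rel α β)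
    {a a' : I → P} {b b' : I → Q}
    (h : ∀ i j, α (Sum.inl (a i)) (Sum.inr (b j)) ↔ i = j)
    (ha : ∀ i, β (Sum.inl (a i)) (Sum.inl (a' i))) (hb : ∀ i, β (Sum.inr (b i)) (Sum.inr (b' i)))
    (hβ : ∀ i, ¬ α (Sum.inl (a' i)) (Sum.inr (b' i))) : S.Col I := by
  have h1 := S.comap a b H
  rw [eq_eT h, comap_congr ha hb] at h1
  exact col_of_irrefl' hI' hI (S.trans h1 (S.symm (S.comap a' b' H))) hβ

lemma noncommon_cases {p₀ : P} {q₀ : Q} (hpq : α (Sum.inl p₀) (Sum.inr q₀))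
    (h : ∃ x, ¬ (α (Sum.inl p₀) x ↔ β (Sum.inl p₀) x)) :
    (∃ p q, α (Sum.inl p₀) (Sum.inl p) ∧ α (Sum.inr q₀) (Sum.inr q) ∧
      ¬ β (Sum.inl p) (Sum.inr q)) ∨
    (∃ p q, β (Sum.inl p₀) (Sum.inl p) ∧ β (Sum.inr q₀) (Sum.inr q) ∧
      ¬ α (Sum.inl p) (Sum.inr q)) := by
  by_cases hβ : β (Sum.inl p₀) (Sum.inr q₀)
  swap
  · exact Or.inl ⟨p₀, q₀, α.refl _, α.refl _, hβ⟩
  obtain ⟨x, hx⟩ := h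
  by_cases h1 : α (Sum.inl p₀) x
  · have h2 : ¬ β (Sum.inl p₀) x := fun h2 => hx ⟨fun _ => h2, fun _ => h1⟩
    left
    rcases x with x | x
    · exact ⟨x, q₀, h1, α.refl _, fun h3 => h2 (β.trans hβ (β.symm h3))⟩
    · exact ⟨p₀, x, α.refl _, α.trans (α.symm hpq) h1, h2⟩
  · have h2 : β (Sum.inl p₀) x := by tauto
    right
    rcases x with x | x
    · exact ⟨x, q₀, h2, β.refl _, fun h3 => h1 (α.trans hpq (α.symm h3))⟩
    · exact ⟨p₀, x, β.refl _, β.trans (β.symm hβ) h2, h1⟩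

lemma col_of_noncommon_aux {I J : Type u} (hI' : Infinite J ∨ Subsingleton J) (hI : #J ≤ #X)
    (H : S.rel α β) {a : I → P} {b : I → Q}
    (h : ∀ i j, α (Sum.inl (a i)) (Sum.inr (b j)) ↔ i = j) (f : J → I) (hf : f.Injective)
    (hJ : (∀ j, ∃ p q, α (Sum.inl (a (f j))) (Sum.inl p) ∧ α (Sum.inr (b (f j))) (Sum.inr q) ∧
      ¬ β (Sum.inl p) (Sum.inr q)) ∨
      (∀ j, ∃ p q, β (Sum.inl (a (f j))) (Sum.inl p) ∧ β (Sum.inr (b (f j))) (Sum.inr q) ∧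
      ¬ α (Sum.inl p) (Sum.inr q))) : S.Col J := by
  rcases hJ with h' | h' <;> choose p q hp hq hpq using h'
  · refine col_of_broken hI' hI H (a := p) (b := q) ?_ hpq
    intro i j
    rw [← hf.eq_iff, ← h]
    exact ⟨fun h => α.trans (hp i) (α.trans h (α.symm (hq j))),
      fun h => α.trans (α.symm (hp i)) (α.trans h (hq j))⟩
  · refine col_of_moved hI' hI H (a := a ∘ f) (b := b ∘ f) ?_ hp hq hpq
    intro i j
    rw [← hf.eq_iff, ← h]
    rfl

/-- If infinitely many transversals are not shared, they can be split. -/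
lemma col_of_noncommon [Infinite I] (hI : #I ≤ #X) (H : S.rel α β) {a : I → P} {b : I → Q}
    (h : ∀ i j, α (Sum.inl (a i)) (Sum.inr (b j)) ↔ i = j)
    (hn : ∀ i, ∃ x, ¬ (α (Sum.inl (a i)) x ↔ β (Sum.inl (a i)) x)) : S.Col I := by
  have hc := fun i => noncommon_cases ((h i i).2 rfl) (hn i)
  rcases pigeonhole_or hc with h' | h'
  · have := Cardinal.infinite_iff.2 (h' ▸ Cardinal.aleph0_le_mk I)
    exact Col.of_le h'.ge (col_of_noncommon_aux (Or.inl this) (h'.trans_le hI) H h _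
      Subtype.val_injective (Or.inl fun j => j.2))
  · have := Cardinal.infinite_iff.2 (h' ▸ Cardinal.aleph0_le_mk I)
    exact Col.of_le h'.ge (col_of_noncommon_aux (Or.inl this) (h'.trans_le hI) H h _
      Subtype.val_injective (Or.inr fun j => j.2))

lemma col_unit_of_noncommon (hX : 1 ≤ #X) (H : S.rel α β) {p₀ : P} {q₀ : Q}
    (h : α (Sum.inl p₀) (Sum.inr q₀))
    (hn : ∃ x, ¬ (α (Sum.inl p₀) x ↔ β (Sum.inl p₀) x)) : S.Col PUnit := by
  have hc := noncommon_cases h hn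
  exact col_of_noncommon_aux (I := PUnit) (Or.inr inferInstance) (by simpa using hX) H
    (a := fun _ => p₀) (b := fun _ => q₀) (by simpa using h) id Function.injective_id
    (hc.imp (fun h _ => h) (fun h _ => h))

end

end Sys

namespace Sys
variable {X : Type u} (S : Sys X)

/-- The relation on partitions without lower points. -/
def trel {V : Type u} (r s : Setoid V) : Prop :=
  S.rel (sumS r (⊥ : Setoid PEmpty.{u + 1})) (sumS s ⊥)

/-- The upper blocks indexed by `N` may be merged. -/
def Mrg (N : Type u) : Prop := S.trel (⊥ : Setoid N) ⊤

variable {S} {V : Type u} {r s : Setoid V}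

lemma trel_lab {V' Z : Type u} (h : V' → V ⊕ Z) (H : S.trel r s) :
    S.trel (Setoid.comap h (sumS r ⊥)) (Setoid.comap h (sumS s ⊥)) := by
  have := S.cmap h (Sum.inl : PEmpty.{u + 1} → PEmpty.{u + 1} ⊕ PEmpty.{u + 1}) H
  unfold trel
  convert this using 1 <;> ext x y <;> rcases x with x | ⟨⟨⟩⟩ <;> rcases y with y | ⟨⟨⟩⟩
  all_goals
    rcases hx : h x with m | z <;> rcases hy : h y with m' | z' <;> simp [cmap_def, hx, hy]

lemma trel_comap {V' : Type u} (f : V' → V) (H : S.trel r s) :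
    S.trel (Setoid.comap f r) (Setoid.comap f s) := by
  have := trel_lab (Z := V) (Sum.inl ∘ f) H
  convert this using 1 <;> ext x y <;> simp

lemma trel_join (hV : #V ≤ #X) (E : Setoid V) (H : S.trel r s) : S.trel (r ⊔ E) (s ⊔ E) := by
  have := S.join E ⊥ hV (by simp) H
  have e : ∀ r : Setoid V, sumS r (⊥ : Setoid PEmpty.{u + 1}) ⊔ sumS E ⊥ = sumS (r ⊔ E) ⊥ := by
    intro r
    refine le_antisymm (sup_le ?_ ?_) ?_
    · rintro (x | ⟨⟨⟩⟩) (y | ⟨⟨⟩⟩) h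
      simp at h ⊢
      exact sup_rel_left h
    · rintro (x | ⟨⟨⟩⟩) (y | ⟨⟨⟩⟩) h
      simp at h ⊢
      exact sup_rel_right h
    · rintro (x | ⟨⟨⟩⟩) (y | ⟨⟨⟩⟩) h
      simp at h
      exact sup_rel_of _ Sum.inl (fun x y h => sup_rel_left (by simpa using h))
        (fun x y h => sup_rel_right (by simpa using h)) h
  rwa [e, e] at this

lemma Mrg.mono {N M : Type u} {f : M → N} (hf : f.Injective) (h : S.Mrg N) : S.Mrg M := by
  have := trel_comap f h
  change S.trel ⊥ ⊤
  convert this using 1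
  · ext x y
    simp [hf.eq_iff]
  · rfl

lemma Mrg.of_le {I M : Type u} (hf : #M ≤ #I) (h : S.Mrg I) : S.Mrg M := by
  obtain ⟨f⟩ := hf
  exact h.mono f.injective

lemma mrg_of_subsingleton {N : Type u} [Subsingleton N] : S.Mrg N := by
  have : (⊥ : Setoid N) = ⊤ := by
    ext x y
    simp [Subsingleton.elim x y]
  unfold Mrg
  rw [this]
  exact S.refl _

lemma mrg_star (hV : #V ≤ #X) (H : S.trel r s) {A : Type u} (c : A → V) (R : Set V)
    (hR : ∀ a, ∃ v ∈ R, s (c a) v) (hc : ∀ a b, r (c a) (c b) → a = b)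
    (hcR : ∀ a, ∀ v ∈ R, ¬ r (c a) v) : S.Mrg A := by
  classical
  let U : Setoid V := Setoid.ker (fun v => if v ∈ R then none else some v)
  have hU : ∀ {v w}, v ∈ R → w ∈ R → U v w := by
    intro v w hv hw
    simp [U, Setoid.ker_def, hv, hw]
  have h1 := trel_comap c (trel_join hV U H)
  change S.trel ⊥ ⊤
  convert h1 using 1
  · ext a b
    refine ⟨fun h => by rw [bot_rel] at h; rw [h], fun h => ?_⟩
    let g : V → Option (Quotient r) := fun v =>
      if ∃ w ∈ R, r v w then none else some (Quotient.mk r v)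
    have hg : g (c a) = g (c b) := by
      refine sup_rel_of ⊥ g ?_ ?_ h
      · intro x y hxy
        have e : (∃ w ∈ R, r x w) ↔ ∃ w ∈ R, r y w :=
          exists_congr fun w => and_congr_right fun _ =>
            ⟨fun h => r.trans (r.symm hxy) h, fun h => r.trans hxy h⟩
        have e2 : Quotient.mk r x = Quotient.mk r y := Quotient.sound hxy
        simp only [bot_rel, g, e, e2]
      · intro x y hxy
        by_cases hx : x ∈ R <;> by_cases hy : y ∈ R <;> simp [U, Setoid.ker_def, hx, hy] at hxy
        · have ex : ∃ w ∈ R, r x w := ⟨x, hx, r.refl x⟩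
          have ey : ∃ w ∈ R, r y w := ⟨y, hy, r.refl y⟩
          simp [g, ex, ey]
        · rw [hxy]
    have ea : ¬ ∃ w ∈ R, r (c a) w := fun ⟨w, hw, h⟩ => hcR a w hw h
    have eb : ¬ ∃ w ∈ R, r (c b) w := fun ⟨w, hw, h⟩ => hcR b w hw h
    simp only [g, ea, eb, if_false, Option.some.injEq] at hg
    exact hc a b (Quotient.exact hg)
  · ext a b
    simp only [top_rel, true_iff]
    obtain ⟨v, hv, hav⟩ := hR a
    obtain ⟨w, hw, hbw⟩ := hR b
    change (s ⊔ U) (c a) (c b)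
    exact Setoid.trans' _ (sup_rel_left hav)
      (Setoid.trans' _ (sup_rel_right (hU hv hw)) (Setoid.symm' _ (sup_rel_left hbw)))

lemma mrg_of_gain (hV : #V ≤ #X) (H : S.trel r s) {N : Type u} [Infinite N] (a z : N → V)
    (ha : ∀ n m, r (a n) (a m) → n = m) (hs : ∀ n, s (a n) (z n)) (hr : ∀ n, ¬ r (a n) (z n)) :
    S.Mrg N := by
  obtain ⟨t, ht, hfree⟩ := exists_free (fun n m => r (z n) (a m))
    (fun i j k h h' => ha j k (r.trans (r.symm h) h')) (fun n h => hr n (r.symm h))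
  refine Mrg.of_le ht.ge (I := t) ?_
  refine mrg_star hV H (fun n : t => a n) (Set.range fun n : t => z n) ?_ ?_ ?_
  · exact fun n => ⟨z n, ⟨n, rfl⟩, hs n⟩
  · exact fun n m h => Subtype.ext (ha n m h)
  · rintro n _ ⟨m, rfl⟩ h
    exact hfree m m.2 n n.2 (r.symm h)

lemma mrg_of_lose (hV : #V ≤ #X) (H : S.trel r s) {N : Type u} [Infinite N] (a z : N → V)
    (ha : ∀ n m, r (a n) (a m) → n = m) (hr : ∀ n, r (a n) (z n)) (hs : ∀ n, ¬ s (a n) (z n)) :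
    S.Mrg N := by
  obtain ⟨A, hA, hA'⟩ := exists_cross (Setoid.comap a s)
  rcases pigeonhole_or (fun i => em (i ∈ A)) with h | h
  · have := Cardinal.infinite_iff.2 (h ▸ Cardinal.aleph0_le_mk N)
    refine Mrg.of_le h.ge ?_
    exact mrg_of_gain hV (S.symm H) (fun n : {i // i ∈ A} => a n) (fun n => z n)
      (fun n m h => Subtype.ext (hA n n.2 m m.2 h)) (fun n => hr n) (fun n => hs n)
  · refine Mrg.of_le h.ge ?_
    refine mrg_star hV H (fun n : {i // i ∉ A} => a n) (a '' A) ?_ ?_ ?_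
    · intro n
      obtain ⟨m, hm, h⟩ := hA' n
      exact ⟨a m, ⟨m, hm, rfl⟩, h⟩
    · exact fun n m h => Subtype.ext (ha n m h)
    · rintro n _ ⟨m, hm, rfl⟩ h
      exact n.2 (ha _ _ h ▸ hm)

lemma mrg_of_bool [Infinite X] (h2 : S.Mrg (ULift Bool)) {N : Type u} [hN : Finite N] :
    S.Mrg N := by
  classical
  induction N using Finite.induction_empty_option with
  | of_equiv e ih => exact ih.mono e.symm.injective
  | h_empty => exact mrg_of_subsingleton
  | @h_option N _ ih =>
    rcases isEmpty_or_nonempty N with hN | ⟨⟨n₀⟩⟩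
    · have : Subsingleton (Option N) :=
        ⟨fun a b => by
          rcases a with _ | a
          · rcases b with _ | b
            · rfl
            · exact hN.elim b
          · exact hN.elim a⟩
      exact mrg_of_subsingleton
    have h1 := trel_lab (Z := PUnit)
      (fun x : Option N => x.elim (Sum.inr PUnit.unit) Sum.inl) ih
    have h2 := trel_lab (Z := N) (fun x : Option N => x.elim (Sum.inl ⟨false⟩)
      (fun n => if n = n₀ then Sum.inl ⟨true⟩ else Sum.inr n)) h2
    set K₁ := Setoid.comap (fun x : Option N => x.elim (Sum.inr PUnit.unit) Sum.inl)
      (sumS (⊤ : Setoid N) (⊥ : Setoid PUnit.{u + 1})) with hK₁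
    set K₂ := Setoid.comap (fun x : Option N => x.elim (Sum.inl (⟨false⟩ : ULift.{u} Bool))
      (fun n => if n = n₀ then Sum.inl ⟨true⟩ else Sum.inr n)) (sumS ⊤ (⊥ : Setoid N)) with hK₂
    have e1 : Setoid.comap (fun x : Option N => x.elim (Sum.inr PUnit.unit) Sum.inl)
      (sumS (⊥ : Setoid N) (⊥ : Setoid PUnit.{u + 1})) = ⊥ := by
      ext x y
      rcases x with _ | x <;> rcases y with _ | y <;> simp
    have e2 : Setoid.comap (fun x : Option N => x.elim (Sum.inl (⟨false⟩ : ULift.{u} Bool))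
        (fun n => if n = n₀ then Sum.inl ⟨true⟩ else Sum.inr n)) (sumS ⊥ (⊥ : Setoid N)) = ⊥ := by
      ext x y
      rcases x with _ | x <;> rcases y with _ | y <;> simp
      · split_ifs <;> simp
      · split_ifs <;> simp
      · by_cases hx : x = n₀ <;> by_cases hy : y = n₀ <;> simp [hx, hy, eq_comm]
        exact fun h => hy h.symm
    rw [e1] at h1
    rw [e2] at h2
    have h3 := trel_join (Cardinal.mk_le_aleph0.trans (Cardinal.aleph0_le_mk X)) K₁ h2
    rw [bot_sup_eq] at h3
    have e3 : K₂ ⊔ K₁ = ⊤ := by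
      ext x y
      have key : ∀ x : Option N, (K₂ ⊔ K₁) x (some n₀) := by
        rintro (_ | x)
        · refine sup_rel_left ?_
          simp [hK₂]
        · refine sup_rel_right ?_
          simp [hK₁]
      exact ⟨fun _ => trivial, fun _ => Setoid.trans' _ (key x) (Setoid.symm' _ (key y))⟩
    rw [e3] at h3
    exact S.trans h1 h3

/-- Upper blocks changed by the relation may be merged. -/
lemma mrg_of_changed [Infinite X] (hV : #V ≤ #X) (H : S.trel r s) {N : Type u} (a z : N → V)
    (ha : ∀ n m, r (a n) (a m) → n = m) (hz : ∀ n, ¬ (r (a n) (z n) ↔ s (a n) (z n))) :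
    S.Mrg N := by
  rcases finite_or_infinite N with hN | hN
  · rcases isEmpty_or_nonempty N with _ | ⟨⟨n⟩⟩
    · exact mrg_of_subsingleton
    refine mrg_of_bool ?_
    have key : ∀ {r s : Setoid V}, S.trel r s → ¬ r (a n) (z n) → s (a n) (z n) →
        S.Mrg (ULift Bool) := by
      intro r s H h1 h2
      have := trel_comap (fun b : ULift.{u} Bool => cond b.down (a n) (z n)) H
      have h1' : ¬ r (z n) (a n) := fun h => h1 (r.symm h)
      have h2' : s (z n) (a n) := s.symm h2
      change S.trel ⊥ ⊤
      convert this using 1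
      · ext ⟨x⟩ ⟨y⟩
        cases x <;> cases y <;> simp [h1, h1', r.refl]
      · ext ⟨x⟩ ⟨y⟩
        cases x <;> cases y <;> simp [h2, h2', s.refl]
    by_cases h : r (a n) (z n)
    · exact key (S.symm H) (fun h' => hz n ⟨fun _ => h', fun _ => h⟩) h
    · exact key H h (by_contra fun h' => hz n ⟨fun h'' => absurd h'' h, fun h'' => absurd h'' h'⟩)
  · have hc : ∀ n, (¬ r (a n) (z n) ∧ s (a n) (z n)) ∨ (r (a n) (z n) ∧ ¬ s (a n) (z n)) := by
      intro n
      have := hz n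
      tauto
    rcases pigeonhole_or hc with h | h
    · have := Cardinal.infinite_iff.2 (h ▸ Cardinal.aleph0_le_mk N)
      refine Mrg.of_le h.ge ?_
      exact mrg_of_gain hV H (fun n : {n // _} => a n) (fun n => z n)
        (fun n m h => Subtype.ext (ha n m h)) (fun n => n.2.2) (fun n => n.2.1)
    · have := Cardinal.infinite_iff.2 (h ▸ Cardinal.aleph0_le_mk N)
      refine Mrg.of_le h.ge ?_
      exact mrg_of_lose hV H (fun n : {n // _} => a n) (fun n => z n)
        (fun n m h => Subtype.ext (ha n m h)) (fun n => n.2.1) (fun n => n.2.2)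

end Sys

/-- The block of `x` is a transversal. -/
def TrPt {P Q : Type*} (ω : Setoid (P ⊕ Q)) (x : P ⊕ Q) : Prop :=
  (∃ p, ω x (Sum.inl p)) ∧ ∃ q, ω x (Sum.inr q)

lemma TrPt.congr {P Q : Type*} {ω : Setoid (P ⊕ Q)} {x y : P ⊕ Q} (h : ω x y) (hx : TrPt ω x) :
    TrPt ω y :=
  ⟨hx.1.imp fun _ h' => ω.trans (ω.symm h) h', hx.2.imp fun _ h' => ω.trans (ω.symm h) h'⟩

namespace Sys
variable {X : Type u} {S : Sys X}

section
variable {P Q : Type u}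

lemma split_of_col {ω : Setoid (P ⊕ Q)} {M : Type u} (hM : S.Col M) (t : P ⊕ Q → M)
    (ht : ∀ x y, TrPt ω x → TrPt ω y → (t x = t y ↔ ω x y)) :
    S.rel ω (sumS (Setoid.comap Sum.inl ω) (Setoid.comap Sum.inr ω)) := by
  classical
  let g : P ⊕ Q → M ⊕ Quotient ω := fun x => if TrPt ω x then Sum.inl (t x) else Sum.inr ⟦x⟧
  have hq : ∀ x y : P ⊕ Q, (⟦x⟧ : Quotient ω) = ⟦y⟧ ↔ ω x y := fun x y => Quotient.eq
  have hg : ∀ x y, g x = g y ↔ ω x y := by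
    intro x y
    by_cases hx : TrPt ω x <;> by_cases hy : TrPt ω y
    · simp [g, hx, hy, ht x y hx hy]
    · simp only [g, hx, hy, if_true, if_false]
      exact ⟨fun h => by simp at h, fun h => absurd (hx.congr h) hy⟩
    · simp only [g, hx, hy, if_true, if_false]
      exact ⟨fun h => by simp at h, fun h => absurd (hy.congr (ω.symm h)) hx⟩
    · simp [g, hx, hy, hq]
  have H := S.cmap (fun p => g (Sum.inl p)) (fun q => g (Sum.inr q)) hM
  have tr : ∀ {p q}, ω (Sum.inl p) (Sum.inr q) → TrPt ω (Sum.inl p) :=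
    fun {p q} h => ⟨⟨p, ω.refl _⟩, q, h⟩
  have tr' : ∀ {p q}, ω (Sum.inl p) (Sum.inr q) → TrPt ω (Sum.inr q) :=
    fun {p q} h => ⟨⟨p, ω.symm h⟩, q, ω.refl _⟩
  have key : ∀ p q, sumS (eT M) (⊥ : Setoid (Quotient ω ⊕ Quotient ω))
      (Sum.map Sum.inl Sum.inl (g (Sum.inl p))) (Sum.map Sum.inr Sum.inr (g (Sum.inr q))) ↔
      ω (Sum.inl p) (Sum.inr q) := by
    intro p q
    constructor
    · intro h
      rw [← hg]
      rcases hp : g (Sum.inl p) with m | z <;> rcases hq : g (Sum.inr q) with m' | z' <;>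
        simp [hp, hq] at h ⊢
      exact h
    · intro h
      have h' := (hg _ _).2 h
      have h2 : g (Sum.inl p) = Sum.inl (t (Sum.inl p)) := if_pos (tr h)
      have h3 : g (Sum.inr q) = Sum.inl (t (Sum.inr q)) := if_pos (tr' h)
      rw [h2, h3] at h' ⊢
      simpa using h'
  convert H using 1
  · ext x y
    rcases x with p | q <;> rcases y with p' | q'
    · rw [← hg]
      rcases hp : g (Sum.inl p) with m | z <;> rcases hq : g (Sum.inl p') with m' | z' <;>
        simp [cmap_def, hp, hq]
    · exact (key p q').symm
    · exact ⟨fun h => Setoid.symm' _ ((key p' q).2 (ω.symm h)),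
        fun h => ω.symm ((key p' q).1 (Setoid.symm' _ h))⟩
    · rw [← hg]
      rcases hp : g (Sum.inr q) with m | z <;> rcases hq : g (Sum.inr q') with m' | z' <;>
        simp [cmap_def, hp, hq]
  · ext x y
    rcases x with p | q <;> rcases y with p' | q'
    · simp only [sumS_inl_inl, comap_rel, ← hg]
      rcases hp : g (Sum.inl p) with m | z <;> rcases hq : g (Sum.inl p') with m' | z' <;>
        simp [cmap_def, hp, hq]
    · rcases hp : g (Sum.inl p) with m | z <;> rcases hq : g (Sum.inr q') with m' | z' <;>
        simp [cmap_def, hp, hq]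
    · rcases hp : g (Sum.inr q) with m | z <;> rcases hq : g (Sum.inl p') with m' | z' <;>
        simp [cmap_def, hp, hq]
    · simp only [sumS_inr_inr, comap_rel, ← hg]
      rcases hp : g (Sum.inr q) with m | z <;> rcases hq : g (Sum.inr q') with m' | z' <;>
        simp [cmap_def, hp, hq]

end

lemma col_of_few {N : Type u} (hN : #N ≤ #X) {ω : Setoid (N ⊕ N)} (H : S.rel (eT N) ω) (k : N)
    (hk : S.Col {x // x ≠ k})
    (hω : ∀ x, TrPt ω x → ∃ p, p ≠ k ∧ ω x (Sum.inl p)) : S.Col N := by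
  classical
  by_cases hne : ∃ i, i ≠ k
  swap
  · have : Subsingleton N := ⟨fun a b => by
      push Not at hne
      rw [hne a, hne b]⟩
    refine col_of_split hN H ?_
    intro i j h
    obtain ⟨p, hp, -⟩ := hω (Sum.inl i) ⟨⟨i, ω.refl _⟩, j, h⟩
    exact hp (Subsingleton.elim _ _)
  obtain ⟨i₀, hi₀⟩ := hne
  have hω' : ∀ c : Quotient ω, ∃ p : {x // x ≠ k}, TrPt ω c.out → ω c.out (Sum.inl p.1) := by
    intro c
    by_cases h : TrPt ω c.out
    · obtain ⟨p, hp, hcp⟩ := hω _ h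
      exact ⟨⟨p, hp⟩, fun _ => hcp⟩
    · exact ⟨⟨i₀, hi₀⟩, fun h' => absurd h' h⟩
  choose f hf using hω'
  have hmk : ∀ x : N ⊕ N, ω x (⟦x⟧ : Quotient ω).out := fun x => Setoid.symm' ω (Quotient.mk_out x)
  have h1 := split_of_col (ω := ω) hk (fun x => f ⟦x⟧) (by
    intro x y hx hy
    constructor
    · intro h
      have e1 := ω.trans (hmk x) (hf _ (hx.congr (hmk x)))
      have e2 := ω.trans (hmk y) (hf _ (hy.congr (hmk y)))
      rw [h] at e1
      exact ω.trans e1 (ω.symm e2)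
    · intro h
      have : (⟦x⟧ : Quotient ω) = ⟦y⟧ := Quotient.sound h
      simp only [this])
  refine col_of_split hN (S.trans H h1) ?_
  intro i j h
  simp at h

lemma col_of_free_top {N : Type u} [Finite N] (hN : #N ≤ #X) {ω : Setoid (N ⊕ N)}
    (H : S.rel (eT N) ω) (i : N) (hi : ∀ j, ¬ ω (Sum.inl i) (Sum.inr j)) : S.Col N := by
  induction hn : Nat.card N using Nat.strong_induction_on generalizing N with
  | _ n ih =>
  by_cases hne : ∃ j, j ≠ i
  swap
  · have : Subsingleton N := ⟨fun a b => by
      push Not at hne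
      rw [hne a, hne b]⟩
    exact col_of_irrefl' (Or.inr this) hN H fun j => by
      rw [Subsingleton.elim j i]
      exact hi i
  obtain ⟨j, hj⟩ := hne
  have h1 := S.comap (fun x : {x // x ≠ j} => x.1) (fun x : {x // x ≠ j} => x.1) H
  rw [comap_eT Subtype.val_injective] at h1
  have hcard : ∀ j : N, Nat.card {x // x ≠ j} = n - 1 := by
    intro j
    have := Fintype.ofFinite N
    classical
    rw [← hn, Nat.card_eq_fintype_card, Nat.card_eq_fintype_card, Fintype.card_subtype_compl]
    simp
  have hpos : 0 < n := hn ▸ Nat.card_pos_iff.2 ⟨⟨i⟩, inferInstance⟩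
  have h2 := ih (n - 1) (by omega) ((Cardinal.mk_subtype_le _).trans hN) h1 ⟨i, hj.symm⟩
    (fun k => hi k) (hcard j)
  have h3 : S.Col {x // x ≠ i} := by
    have e : Nat.card {x // x ≠ i} = Nat.card {x // x ≠ j} := by rw [hcard, hcard]
    exact h2.mono (Finite.card_eq.1 e).some.injective
  refine col_of_few hN H i h3 ?_
  rintro x ⟨⟨p, hp⟩, q, hq⟩
  refine ⟨p, ?_, hp⟩
  rintro rfl
  exact hi q (ω.trans (ω.symm hp) hq)

section
variable {P Q N : Type u} [Finite N] {α β : Setoid (P ⊕ Q)}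

lemma col_of_free_top' (hN : #N ≤ #X) (H : S.rel α β) {a : N → P} {b : N → Q}
    (h : ∀ i j, α (Sum.inl (a i)) (Sum.inr (b j)) ↔ i = j) (i : N)
    (hi : ∀ j, ¬ β (Sum.inl (a i)) (Sum.inr (b j))) : S.Col N := by
  have h1 := S.comap a b H
  rw [eq_eT h] at h1
  exact col_of_free_top hN h1 i hi

lemma col_of_moved_top (hN : #N ≤ #X) (H : S.rel α β) {a a' : N → P} {b : N → Q}
    (h : ∀ i j, α (Sum.inl (a i)) (Sum.inr (b j)) ↔ i = j)
    (ha : ∀ i, β (Sum.inl (a i)) (Sum.inl (a' i))) (i : N)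
    (hi : ∀ j, ¬ α (Sum.inl (a' i)) (Sum.inr (b j))) : S.Col N := by
  have h1 := S.comap a b H
  rw [eq_eT h, comap_congr ha (fun _ => β.refl _)] at h1
  exact col_of_free_top hN (S.trans h1 (S.symm (S.comap a' b H))) i hi

lemma col_of_merged_tops (hN : #N ≤ #X) (H : S.rel α β) {a : N → P} {b : N → Q}
    (h : ∀ i j, α (Sum.inl (a i)) (Sum.inr (b j)) ↔ i = j) {i k : N} (hik : i ≠ k)
    (hβ : β (Sum.inl (a i)) (Sum.inl (a k))) : S.Col N := by
  classical
  have h0 := S.comap a b H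
  rw [eq_eT h] at h0
  refine col_of_few hN h0 k ?_ ?_
  · refine col_of_moved_top (N := {x // x ≠ k}) (a := fun x => a x.1)
      (a' := fun x => if x.1 = i then a k else a x.1) (b := fun x => b x.1)
      ((Cardinal.mk_subtype_le _).trans hN) H ?_ ?_ ⟨i, hik⟩ ?_
    · intro i j
      rw [h, Subtype.ext_iff]
    · intro x
      split_ifs with hx
      · rw [hx]; exact hβ
      · exact β.refl _
    · intro j
      simp [h, j.2.symm]
  · rintro x ⟨⟨p, hp⟩, -⟩
    by_cases hpk : p = k
    · refine ⟨i, hik, Setoid.trans' _ hp ?_⟩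
      rw [hpk]
      exact β.symm hβ
    · exact ⟨p, hpk, hp⟩

end

end Sys

/-- Interchanging the upper and the lower points of a partition. -/
def flip {P Q : Type*} (α : Setoid (P ⊕ Q)) : Setoid (Q ⊕ P) := Setoid.comap Sum.swap α

@[simp] lemma flip_rel {P Q : Type*} (α : Setoid (P ⊕ Q)) (x y : Q ⊕ P) :
    flip α x y ↔ α x.swap y.swap := Iff.rfl

@[simp] lemma flip_flip {P Q : Type*} (α : Setoid (P ⊕ Q)) : flip (flip α) = α := by
  ext x y
  simp

lemma trPt_flip {P Q : Type*} {α : Setoid (P ⊕ Q)} {x : Q ⊕ P} :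
    TrPt (flip α) x ↔ TrPt α x.swap := by
  simp [TrPt, and_comm]

namespace Sys
variable {X : Type u} {S : Sys X}

lemma dual_rel {P Q : Type u} {α β : Setoid (P ⊕ Q)} (H : S.rel α β) :
    S.dual.rel (flip α) (flip β) := by
  change S.rel (flip (flip α)) (flip (flip β))
  rwa [flip_flip, flip_flip]

lemma mk_le_of_finite [Infinite X] (N : Type u) [Finite N] : #N ≤ #X :=
  Cardinal.mk_le_aleph0.trans (Cardinal.aleph0_le_mk X)

lemma col_of_nontr [Infinite X] {P Q N : Type u} [Finite N] {α β : Setoid (P ⊕ Q)} (hP : #P ≤ #X)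
    (hQ : #Q ≤ #X) (H : S.rel α β) {a : N → P} {b : N → Q}
    (h : ∀ i j, α (Sum.inl (a i)) (Sum.inr (b j)) ↔ i = j) (i : N) {p q : P}
    (hpq : α (Sum.inl p) (Sum.inl q)) (hp : ¬ TrPt α (Sum.inl p))
    (hpq' : ¬ β (Sum.inl p) (Sum.inl q)) (hp' : ¬ TrPt β (Sum.inl p)) (hq' : ¬ TrPt β (Sum.inl q))
    (hs : ¬ β (Sum.inl q) (Sum.inl (a i))) : S.Col N := by
  classical
  let E : Setoid P := Setoid.ker (fun x => if x = p then a i else x)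
  have hE : E p (a i) := by simp [E, Setoid.ker_def]
  have hEg : ∀ (γ : Setoid (P ⊕ Q)) {x y : P ⊕ Q}, (γ ⊔ sumS E ⊥) x y →
      (if γ x (Sum.inl p) then (⟦Sum.inl (a i)⟧ : Quotient γ) else ⟦x⟧) =
      (if γ y (Sum.inl p) then (⟦Sum.inl (a i)⟧ : Quotient γ) else ⟦y⟧) := by
    intro γ x y
    refine sup_rel_of ⊥ (fun x => if γ x (Sum.inl p) then (⟦Sum.inl (a i)⟧ : Quotient γ) else ⟦x⟧)
      ?_ ?_
    · intro x y hxy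
      have e : γ x (Sum.inl p) ↔ γ y (Sum.inl p) :=
        ⟨fun h => γ.trans (γ.symm hxy) h, fun h => γ.trans hxy h⟩
      have e2 : (⟦x⟧ : Quotient γ) = ⟦y⟧ := Quotient.sound hxy
      simp only [bot_rel, e, e2]
    · have key : ∀ u : P, (if γ (Sum.inl u) (Sum.inl p) then (⟦Sum.inl (a i)⟧ : Quotient γ)
          else ⟦Sum.inl u⟧) = if γ (Sum.inl (if u = p then a i else u)) (Sum.inl p) then
          (⟦Sum.inl (a i)⟧ : Quotient γ) else ⟦Sum.inl (if u = p then a i else u)⟧ := by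
        intro u
        by_cases hu : u = p
        · subst hu
          simp [γ.refl]
        · simp [hu]
      rintro (x | x) (y | y) hxy <;> simp at hxy
      · have : (if x = p then a i else x) = if y = p then a i else y := hxy
        rw [bot_rel, key x, key y, this]
      · rw [hxy]
  have hj := S.join E ⊥ hP hQ H
  refine col_of_free_top' (mk_le_of_finite N) hj (a := Function.update a i q) (b := b) ?_ i ?_
  · intro k j
    have hb : ¬ α (Sum.inr (b j)) (Sum.inl p) := fun h' => hp ⟨⟨p, α.refl _⟩, b j, α.symm h'⟩
    constructor
    · intro h'
      have := hEg α h'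
      by_cases hk : k = i
      · subst hk
        simp only [Function.update_self, α.symm hpq, hb, if_true, if_false] at this
        exact (h k j).1 (Quotient.exact this)
      · have hk' : ¬ α (Sum.inl (a k)) (Sum.inl p) := fun h' =>
          hp ⟨⟨p, α.refl _⟩, b k, α.trans (α.symm h') ((h k k).2 rfl)⟩
        simp only [Function.update_of_ne hk, hb, hk', if_false] at this
        exact (h k j).1 (Quotient.exact this)
    · rintro rfl
      have hk := (h k k).2 rfl
      by_cases hki : k = i
      · subst hki
        rw [Function.update_self]
        have h1 : (α ⊔ sumS E ⊥) (Sum.inl q) (Sum.inl p) := sup_rel_left (α.symm hpq)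
        have h2 : (α ⊔ sumS E ⊥) (Sum.inl p) (Sum.inl (a k)) := sup_rel_right (by simpa using hE)
        exact Setoid.trans' _ h1 (Setoid.trans' _ h2 (sup_rel_left hk))
      · rw [Function.update_of_ne hki]
        exact sup_rel_left hk
  · intro j h'
    rw [Function.update_self] at h'
    have := hEg β h'
    have hb : ¬ β (Sum.inr (b j)) (Sum.inl p) := fun h' => hp' ⟨⟨p, β.refl _⟩, b j, β.symm h'⟩
    have hq : ¬ β (Sum.inl q) (Sum.inl p) := fun h' => hpq' (β.symm h')
    simp only [hb, hq, if_false] at this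
    exact hq' ⟨⟨q, β.refl _⟩, b j, Quotient.exact this⟩

/-- All the transversals of `α` are indexed by a finite type of transversals that cannot be
split. -/
structure FinFam (S : Sys X) {P Q N : Type u} (α β : Setoid (P ⊕ Q)) (a : N → P) (b : N → Q) :
    Prop where
  rel : S.rel α β
  iff : ∀ i j, α (Sum.inl (a i)) (Sum.inr (b j)) ↔ i = j
  all : ∀ x, TrPt α x → ∃ i, α x (Sum.inl (a i))
  col : ¬ S.Col N
  hP : #P ≤ #X
  hQ : #Q ≤ #X

namespace FinFam
variable {P Q N : Type u} {α β : Setoid (P ⊕ Q)} {a : N → P} {b : N → Q}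

lemma ab (F : FinFam S α β a b) (i : N) : α (Sum.inl (a i)) (Sum.inr (b i)) := (F.iff i i).2 rfl

lemma aa (F : FinFam S α β a b) {i j : N} (h : α (Sum.inl (a i)) (Sum.inl (a j))) : i = j :=
  (F.iff i j).1 (α.trans h (F.ab j))

lemma flip (F : FinFam S α β a b) :
    FinFam S.dual (PartitionCongruences.flip α) (PartitionCongruences.flip β) b a where
  rel := dual_rel F.rel
  iff i j := by
    rw [eq_comm, ← F.iff]
    exact ⟨α.symm, α.symm⟩
  all x hx := by
    obtain ⟨i, hi⟩ := F.all _ (trPt_flip.1 hx)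
    exact ⟨i, α.trans hi (F.ab i)⟩
  col := by
    rw [col_dual]
    exact F.col
  hP := F.hQ
  hQ := F.hP

lemma tr (F : FinFam S α β a b) (i : N) : TrPt α (Sum.inl (a i)) := ⟨⟨_, α.refl _⟩, _, F.ab i⟩

lemma update [DecidableEq N] (F : FinFam S α β a b) {i : N} {p : P}
    (hp : α (Sum.inl p) (Sum.inl (a i))) : FinFam S α β (Function.update a i p) b := by
  have key : ∀ j, α (Sum.inl (Function.update a i p j)) (Sum.inl (a j)) := by
    intro j
    by_cases hj : j = i
    · subst hj
      rwa [Function.update_self]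
    · rw [Function.update_of_ne hj]
  refine ⟨F.rel, fun k j => ?_, fun x hx => ?_, F.col, F.hP, F.hQ⟩
  · rw [← F.iff]
    exact ⟨fun h => α.trans (α.symm (key k)) h, fun h => α.trans (key k) h⟩
  · obtain ⟨j, hj⟩ := F.all x hx
    exact ⟨j, α.trans hj (α.symm (key j))⟩

variable [Infinite X] [Finite N]

lemma exists_match (F : FinFam S α β a b) (i : N) :
    ∃ j, β (Sum.inl (a i)) (Sum.inr (b j)) := by
  by_contra hc
  push Not at hc
  exact F.col (col_of_free_top' (mk_le_of_finite N) F.rel F.iff i hc)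

lemma tops (F : FinFam S α β a b) {i k : N} (h : β (Sum.inl (a i)) (Sum.inl (a k))) : i = k := by
  by_contra hc
  exact F.col (col_of_merged_tops (mk_le_of_finite N) F.rel F.iff hc h)

lemma exists_perm (F : FinFam S α β a b) : ∃ f : N → N, f.Bijective ∧
    ∀ i, β (Sum.inl (a i)) (Sum.inr (b (f i))) := by
  choose f hf using F.exists_match
  refine ⟨f, Finite.injective_iff_bijective.1 ?_, hf⟩
  intro i k h
  have := hf i
  rw [h] at this
  exact F.tops (β.trans this (β.symm (hf k)))

lemma keep (F : FinFam S α β a b) {i : N} {p : P} (hp : α (Sum.inl p) (Sum.inl (a i))) :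
    β (Sum.inl p) (Sum.inl (a i)) := by
  classical
  obtain ⟨f, hf, hfβ⟩ := F.exists_perm
  have F' := F.update hp
  obtain ⟨j, hj⟩ := F'.exists_match i
  obtain ⟨m, rfl⟩ := hf.2 j
  rw [Function.update_self] at hj
  have h1 := β.trans hj (β.symm (hfβ m))
  by_cases hm : m = i
  · rwa [hm] at h1
  · exact absurd (F'.tops (i := i) (k := m)
      (by rwa [Function.update_self, Function.update_of_ne hm])) (Ne.symm hm)

lemma apart (F : FinFam S α β a b) {i : N} {p : P} (hp : ¬ TrPt α (Sum.inl p)) :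
    ¬ β (Sum.inl p) (Sum.inl (a i)) := by
  classical
  intro h
  refine F.col (col_of_moved_top (mk_le_of_finite N) F.rel (a' := Function.update a i p)
    F.iff ?_ i ?_)
  · intro j
    by_cases hj : j = i
    · subst hj
      rw [Function.update_self]
      exact β.symm h
    · rw [Function.update_of_ne hj]
  · intro j h'
    rw [Function.update_self] at h'
    exact hp ⟨⟨p, α.refl _⟩, _, h'⟩

lemma nontr (F : FinFam S α β a b) {p : P} (hp : ¬ TrPt α (Sum.inl p)) :
    ¬ TrPt β (Sum.inl p) := by
  rintro ⟨-, q, hq⟩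
  obtain ⟨f, hf, hfβ⟩ := F.exists_perm
  refine F.col (Col.mono (I := Option N) (Option.some_injective N) ?_)
  refine col_of_free_top' (mk_le_of_finite _) (S.symm F.rel) (a := fun x => x.elim p a)
    (b := fun x => x.elim q (b ∘ f)) ?_ none ?_
  · rintro (_ | i) (_ | j)
    · simpa using hq
    · simp only [Option.elim_none, Option.elim_some, Function.comp, reduceCtorEq, iff_false]
      exact fun h => F.apart hp (β.trans h (β.symm (hfβ j)))
    · simp only [Option.elim_none, Option.elim_some, Function.comp, reduceCtorEq, iff_false]
      exact fun h => F.apart hp (β.trans hq (β.symm h))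
    · simp only [Option.elim_some, Function.comp, Option.some.injEq]
      refine ⟨fun h => F.tops (β.trans h (β.symm (hfβ j))), fun h => h ▸ hfβ i⟩
  · intro j h
    exact hp ⟨⟨p, α.refl _⟩, _, h⟩

lemma tr_iff (F : FinFam S α β a b) (p : P) : TrPt β (Sum.inl p) ↔ TrPt α (Sum.inl p) := by
  refine ⟨fun h => by_contra fun h' => F.nontr h' h, fun h => ?_⟩
  obtain ⟨i, hi⟩ := F.all _ h
  obtain ⟨j, hj⟩ := F.exists_match i
  exact ⟨⟨p, β.refl _⟩, _, β.trans (F.keep hi) hj⟩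

lemma nontr_iff (F : FinFam S α β a b) (i : N) {p q : P} (hp : ¬ TrPt α (Sum.inl p))
    (hq : ¬ TrPt α (Sum.inl q)) :
    α (Sum.inl p) (Sum.inl q) ↔ β (Sum.inl p) (Sum.inl q) := by
  constructor
  · intro h
    by_contra h'
    exact F.col (col_of_nontr F.hP F.hQ F.rel F.iff i h hp h' (F.nontr hp) (F.nontr hq)
      (F.apart hq))
  · intro h
    by_contra h'
    obtain ⟨f, hf, hfβ⟩ := F.exists_perm
    refine F.col (col_of_nontr F.hP F.hQ (S.symm F.rel) (b := b ∘ f) (a := a) ?_ i h (F.nontr hp)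
      h' hp hq fun hc => hq ((F.tr i).congr (α.symm hc)))
    intro i j
    exact ⟨fun h => F.tops (β.trans h (β.symm (hfβ j))), fun h => h ▸ hfβ i⟩

lemma top_iff (F : FinFam S α β a b) (i : N) (p q : P) :
    α (Sum.inl p) (Sum.inl q) ↔ β (Sum.inl p) (Sum.inl q) := by
  by_cases hp : TrPt α (Sum.inl p) <;> by_cases hq : TrPt α (Sum.inl q)
  · obtain ⟨j, hj⟩ := F.all _ hp
    obtain ⟨k, hk⟩ := F.all _ hq
    have e1 : α (Sum.inl p) (Sum.inl q) ↔ j = k :=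
      ⟨fun h => F.aa (α.trans (α.symm hj) (α.trans h hk)), fun h => by
        subst h; exact α.trans hj (α.symm hk)⟩
    rw [e1]
    constructor
    · intro h
      subst h
      exact β.trans (F.keep hj) (β.symm (F.keep hk))
    · exact fun h => F.tops (β.trans (β.symm (F.keep hj)) (β.trans h (F.keep hk)))
  · exact ⟨fun h => absurd (hp.congr h) hq, fun h =>
      absurd (((F.tr_iff p).2 hp).congr h) (F.nontr hq)⟩
  · exact ⟨fun h => absurd (hq.congr (α.symm h)) hp, fun h =>
      absurd (((F.tr_iff q).2 hq).congr (β.symm h)) (F.nontr hp)⟩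
  · exact F.nontr_iff i hp hq

end FinFam

/-- The two partitions only differ by a permutation of finitely many transversals which cannot be
split. -/
def Exc (S : Sys X) {P Q : Type u} (α β : Setoid (P ⊕ Q)) : Prop :=
  ∃ (N Z Z' : Type u) (_ : Finite N) (ω : Setoid (N ⊕ N)) (h : P → N ⊕ Z) (k : Q → N ⊕ Z'),
    α = PartitionCongruences.cmap h k (eT N) ∧ β = PartitionCongruences.cmap h k ω ∧
    S.rel (eT N) ω ∧ ¬ S.Col N ∧
    (∀ i j, ω (Sum.inl i) (Sum.inl j) → i = j) ∧ ∀ i j, ω (Sum.inr i) (Sum.inr j) → i = j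

lemma FinFam.exc [Infinite X] {P Q N : Type u} [Finite N] {α β : Setoid (P ⊕ Q)} {a : N → P}
    {b : N → Q} (F : FinFam S α β a b) (i₀ : N) : Exc S α β := by
  classical
  have hidx : ∀ x : P ⊕ Q, ∃ i, TrPt α x → α x (Sum.inl (a i)) := by
    intro x
    by_cases hx : TrPt α x
    · exact (F.all x hx).imp fun i hi _ => hi
    · exact ⟨i₀, fun h => absurd h hx⟩
  choose t ht using hidx
  let g : P ⊕ Q → N ⊕ Quotient α := fun x => if TrPt α x then Sum.inl (t x) else Sum.inr ⟦x⟧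
  have hq : ∀ x y : P ⊕ Q, (⟦x⟧ : Quotient α) = ⟦y⟧ ↔ α x y := fun x y => Quotient.eq
  have htt : ∀ x y, TrPt α x → TrPt α y → (t x = t y ↔ α x y) := by
    intro x y hx hy
    constructor
    · intro h
      have := ht x hx
      rw [h] at this
      exact α.trans this (α.symm (ht y hy))
    · exact fun h => F.aa (α.trans (α.symm (ht x hx)) (α.trans h (ht y hy)))
  have keepr : ∀ {q}, TrPt α (Sum.inr q) → β (Sum.inr q) (Sum.inr (b (t (Sum.inr q)))) := by
    intro q hq
    have := F.flip.keep (i := t (Sum.inr q)) (p := q) (α.trans (ht _ hq) (F.ab _))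
    simpa using this
  have nontr_r : ∀ {q}, ¬ TrPt α (Sum.inr q) → ¬ TrPt β (Sum.inr q) := by
    intro q hq
    have := F.flip.nontr (p := q) (fun h => hq (trPt_flip.1 h))
    exact fun h => this (trPt_flip.2 h)
  refine ⟨N, Quotient α, Quotient α, inferInstance, Setoid.comap (Sum.map a b) β,
    fun p => g (Sum.inl p), fun q => g (Sum.inr q), ?_, ?_, ?_, F.col, ?_, ?_⟩
  · have mix : ∀ p q, α (Sum.inl p) (Sum.inr q) ↔ PartitionCongruences.cmap (fun p => g (Sum.inl p))
        (fun q => g (Sum.inr q)) (eT N) (Sum.inl p) (Sum.inr q) := by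
      intro p q
      by_cases hp : TrPt α (Sum.inl p) <;> by_cases hq : TrPt α (Sum.inr q)
      · simp [cmap_def, g, hp, hq, htt]
      all_goals
        simp only [cmap_def, Sum.elim_inl, Sum.elim_inr, Function.comp, g, hp, hq, if_true,
          if_false, Sum.map_inl, Sum.map_inr, sumS_inl_inr, sumS_inr_inl, sumS_inr_inr, bot_rel,
          iff_false, Sum.inr.injEq, reduceCtorEq]
        intro h
      · exact hq (hp.congr h)
      · exact hp (hq.congr (α.symm h))
      · exact hp ⟨⟨p, α.refl _⟩, q, h⟩
    ext x y
    rcases x with p | q <;> rcases y with p' | q'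
    · by_cases hp : TrPt α (Sum.inl p) <;> by_cases hp' : TrPt α (Sum.inl p')
      · simp [cmap_def, g, hp, hp', htt]
      · simp only [cmap_def, Function.comp, g, hp, hp', if_true, if_false, Sum.elim_inl, Sum.map_inl,
          Sum.map_inr, sumS_inl_inr, iff_false]
        exact fun h => hp' (hp.congr h)
      · simp only [cmap_def, Function.comp, g, hp, hp', if_true, if_false, Sum.elim_inl, Sum.map_inl,
          Sum.map_inr, sumS_inr_inl, iff_false]
        exact fun h => hp (hp'.congr (α.symm h))
      · simp [cmap_def, g, hp, hp', hq]
    · exact mix p q'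
    · exact ⟨fun h => Setoid.symm' _ ((mix p' q).1 (α.symm h)),
        fun h => α.symm ((mix p' q).2 (Setoid.symm' _ h))⟩
    · by_cases hp : TrPt α (Sum.inr q) <;> by_cases hp' : TrPt α (Sum.inr q')
      · simp [cmap_def, g, hp, hp', htt]
      · simp only [cmap_def, Function.comp, g, hp, hp', if_true, if_false, Sum.elim_inr, Sum.map_inl,
          Sum.map_inr, sumS_inl_inr, iff_false]
        exact fun h => hp' (hp.congr h)
      · simp only [cmap_def, Function.comp, g, hp, hp', if_true, if_false, Sum.elim_inr, Sum.map_inl,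
          Sum.map_inr, sumS_inr_inl, iff_false]
        exact fun h => hp (hp'.congr (α.symm h))
      · simp [cmap_def, g, hp, hp', hq]
  · have hb : ∀ {i j : N}, β (Sum.inr (b i)) (Sum.inr (b j)) ↔ i = j :=
      fun {i j} => ⟨fun h => F.flip.tops (i := i) (k := j) h, fun h => h ▸ β.refl _⟩
    have ha : ∀ {i j : N}, β (Sum.inl (a i)) (Sum.inl (a j)) ↔ i = j :=
      fun {i j} => ⟨fun h => F.tops (i := i) (k := j) h, fun h => h ▸ β.refl _⟩
    have mix : ∀ p q, β (Sum.inl p) (Sum.inr q) ↔ PartitionCongruences.cmap (fun p => g (Sum.inl p))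
        (fun q => g (Sum.inr q)) (Setoid.comap (Sum.map a b) β) (Sum.inl p) (Sum.inr q) := by
      intro p q
      by_cases hp : TrPt α (Sum.inl p) <;> by_cases hq : TrPt α (Sum.inr q)
      · simp only [cmap_def, Sum.elim_inl, Sum.elim_inr, Function.comp, g, hp, hq, if_true,
          Sum.map_inl, Sum.map_inr, sumS_inl_inl, comap_rel]
        have h1 := F.keep (ht _ hp)
        have h2 := keepr hq
        exact ⟨fun h => β.trans (β.symm h1) (β.trans h h2),
          fun h => β.trans h1 (β.trans h (β.symm h2))⟩
      all_goals
        simp only [cmap_def, Sum.elim_inl, Sum.elim_inr, Function.comp, g, hp, hq, if_true,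
          if_false, Sum.map_inl, Sum.map_inr, sumS_inl_inr, sumS_inr_inl, sumS_inr_inr, bot_rel,
          iff_false, Sum.inr.injEq, reduceCtorEq]
        intro h
      · exact nontr_r hq ⟨⟨p, β.symm h⟩, q, β.refl _⟩
      · exact F.nontr hp ⟨⟨p, β.refl _⟩, q, h⟩
      · exact F.nontr hp ⟨⟨p, β.refl _⟩, q, h⟩
    ext x y
    rcases x with p | q <;> rcases y with p' | q'
    · rw [← F.top_iff i₀]
      by_cases hp : TrPt α (Sum.inl p) <;> by_cases hp' : TrPt α (Sum.inl p')
      · simp [cmap_def, g, hp, hp', ← htt, ha]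
      · simp only [cmap_def, Function.comp, g, hp, hp', if_true, if_false, Sum.elim_inl, Sum.map_inl,
          Sum.map_inr, sumS_inl_inr, iff_false]
        exact fun h => hp' (hp.congr h)
      · simp only [cmap_def, Function.comp, g, hp, hp', if_true, if_false, Sum.elim_inl, Sum.map_inl,
          Sum.map_inr, sumS_inr_inl, iff_false]
        exact fun h => hp (hp'.congr (α.symm h))
      · simp [cmap_def, g, hp, hp', hq]
    · exact mix p q'
    · exact ⟨fun h => Setoid.symm' _ ((mix p' q).1 (β.symm h)),
        fun h => β.symm ((mix p' q).2 (Setoid.symm' _ h))⟩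
    · have e := F.flip.top_iff i₀ q q'
      simp only [flip_rel, Sum.swap_inl] at e
      rw [← e]
      by_cases hp : TrPt α (Sum.inr q) <;> by_cases hp' : TrPt α (Sum.inr q')
      · simp [cmap_def, g, hp, hp', ← htt, hb]
      · simp only [cmap_def, Function.comp, g, hp, hp', if_true, if_false, Sum.elim_inr, Sum.map_inl,
          Sum.map_inr, sumS_inl_inr, iff_false]
        exact fun h => hp' (hp.congr h)
      · simp only [cmap_def, Function.comp, g, hp, hp', if_true, if_false, Sum.elim_inr, Sum.map_inl,
          Sum.map_inr, sumS_inr_inl, iff_false]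
        exact fun h => hp (hp'.congr (α.symm h))
      · simp [cmap_def, g, hp, hp', hq]
  · have := S.comap a b F.rel
    rwa [eq_eT F.iff] at this
  · exact fun i j h => F.tops h
  · exact fun i j h => F.flip.tops (i := i) (k := j) h

end Sys

lemma comap_ext {J J' P P' Q Q' : Type u} {f : J' → J} (hf : f.Injective) (g : P' → P) (k : Q' → Q)
    (ω : Setoid (P ⊕ Q)) : Setoid.comap (Sum.map (Sum.map f g) (Sum.map f k)) (ext J ω) =
      ext J' (Setoid.comap (Sum.map g k) ω) := by
  ext x y
  rcases x with (x | x) | (x | x) <;> rcases y with (y | y) | (y | y) <;>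
    simp [ext_def, hf.eq_iff]

namespace Sys
variable {X : Type u} (S : Sys X)

/-- In the presence of transversals indexed by `J`, the transversals indexed by `I` may be
split. -/
def SplitIn (J I : Type u) : Prop := S.rel (ext J (eT I)) (ext J ⊥)

/-- In the presence of transversals indexed by `J`, the upper blocks indexed by `N` may be
merged. -/
def MergeIn (J N : Type u) : Prop :=
  S.rel (ext J (sumS (⊥ : Setoid N) (⊥ : Setoid PEmpty.{u + 1}))) (ext J (sumS ⊤ ⊥))

variable {S}

lemma SplitIn.of_le {J J' I I' : Type u} (hJ : #J' ≤ #J) (hI : #I' ≤ #I) (h : S.SplitIn J I) :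
    S.SplitIn J' I' := by
  obtain ⟨f⟩ := hJ
  obtain ⟨g⟩ := hI
  have := S.comap (Sum.map f g) (Sum.map f g) h
  rwa [comap_ext f.injective, comap_ext f.injective, comap_eT g.injective,
    comap_bot g.injective g.injective] at this

lemma MergeIn.of_le {J J' N N' : Type u} (hJ : #J' ≤ #J) (hN : #N' ≤ #N) (h : S.MergeIn J N) :
    S.MergeIn J' N' := by
  obtain ⟨f⟩ := hJ
  obtain ⟨g⟩ := hN
  have := S.comap (Sum.map f g) (Sum.map f id) h
  rw [comap_ext f.injective, comap_ext f.injective] at this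
  unfold MergeIn
  convert this using 2 <;> ext x y <;> rcases x with x | ⟨⟨⟩⟩ <;> rcases y with y | ⟨⟨⟩⟩ <;>
    simp [g.injective.eq_iff]

variable {P Q : Type u}

lemma rel_of_splitIn {J I : Type u} (H : S.SplitIn J I) {γ γ' : Setoid (P ⊕ Q)}
    (t : P ⊕ Q → Option J) (s : P ⊕ Q → Option I)
    (ht : ∀ x y, γ x y → t x = t y) (ht' : ∀ x y j, t x = some j → t y = some j → γ x y)
    (hs : ∀ x y, γ x y → s x = s y) (hs' : ∀ x y j, s x = some j → s y = some j → γ x y)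
    (hts : ∀ x i, s x = some i → t x = none)
    (hc : ∀ p q, γ (Sum.inl p) (Sum.inr q) → t (Sum.inl p) = none → s (Sum.inl p) ≠ none)
    (hγ' : ∀ x y, γ' x y ↔ γ x y ∧ (x.isLeft = y.isLeft ∨ t x ≠ none)) : S.rel γ γ' := by
  let g : P ⊕ Q → (J ⊕ I) ⊕ Quotient γ := fun x =>
    (t x).elim ((s x).elim (Sum.inr ⟦x⟧) fun i => Sum.inl (Sum.inr i)) fun j => Sum.inl (Sum.inl j)
  have hq : ∀ x y : P ⊕ Q, (⟦x⟧ : Quotient γ) = ⟦y⟧ ↔ γ x y := fun x y => Quotient.eq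
  have := S.cmap (fun p => g (Sum.inl p)) (fun q => g (Sum.inr q)) H
  convert this using 1
  · ext x y
    rcases hx : t x with _ | j <;> rcases hy : t y with _ | j' <;>
    rcases hx' : s x with _ | i <;> rcases hy' : s y with _ | i' <;>
    rcases x with x | x <;> rcases y with y | y <;>
    simp [cmap_def, g, hx, hy, hx', hy', ext_def, hq] <;> grind
  · ext x y
    rw [hγ']
    rcases hx : t x with _ | j <;> rcases hy : t y with _ | j' <;>
    rcases hx' : s x with _ | i <;> rcases hy' : s y with _ | i' <;>
    rcases x with x | x <;> rcases y with y | y <;>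
    simp [cmap_def, g, hx, hy, hx', hy', ext_def, hq] <;> grind

lemma rel_of_mergeIn {J N : Type u} (H : S.MergeIn J N) {γ γ' : Setoid (P ⊕ Q)}
    (t : P ⊕ Q → Option J) (s : P ⊕ Q → Option N)
    (ht : ∀ x y, γ x y → t x = t y) (ht' : ∀ x y j, t x = some j → t y = some j → γ x y)
    (hs : ∀ p p', γ (Sum.inl p) (Sum.inl p') → s (Sum.inl p) = s (Sum.inl p'))
    (hs' : ∀ x y j, s x = some j → s y = some j → γ x y)
    (hts : ∀ x i, s x = some i → t x = none) (hsr : ∀ q, s (Sum.inr q) = none)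
    (hc : ∀ p q, γ (Sum.inl p) (Sum.inr q) → t (Sum.inl p) ≠ none)
    (hγ' : ∀ x y, γ' x y ↔ γ x y ∨ s x ≠ none ∧ s y ≠ none) : S.rel γ γ' := by
  let g : P → (J ⊕ N) ⊕ Quotient γ := fun x => (t (Sum.inl x)).elim
    ((s (Sum.inl x)).elim (Sum.inr ⟦Sum.inl x⟧) fun i => Sum.inl (Sum.inr i))
    fun j => Sum.inl (Sum.inl j)
  let k : Q → (J ⊕ PEmpty.{u + 1}) ⊕ Quotient γ := fun x => (t (Sum.inr x)).elim
    (Sum.inr ⟦Sum.inr x⟧) fun j => Sum.inl (Sum.inl j)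
  have hq : ∀ x y : P ⊕ Q, (⟦x⟧ : Quotient γ) = ⟦y⟧ ↔ γ x y := fun x y => Quotient.eq
  have hsy : ∀ {x y}, γ x y → γ y x := γ.symm
  have := S.cmap g k H
  convert this using 1
  · ext x y
    rcases hx : t x with _ | j <;> rcases hy : t y with _ | j' <;>
    rcases hx' : s x with _ | i <;> rcases hy' : s y with _ | i' <;>
    rcases x with x | x <;> rcases y with y | y <;>
    simp [cmap_def, g, k, hx, hy, hx', hy', ext_def, hq] <;> grind
  · ext x y
    rw [hγ']
    rcases hx : t x with _ | j <;> rcases hy : t y with _ | j' <;>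
    rcases hx' : s x with _ | i <;> rcases hy' : s y with _ | i' <;>
    rcases x with x | x <;> rcases y with y | y <;>
    simp [cmap_def, g, k, hx, hy, hx', hy', ext_def, hq] <;> grind

end Sys

section common
variable {P Q : Type u}

/-- The point `x` has the same block in both partitions. -/
def SameBlock (α β : Setoid (P ⊕ Q)) (x : P ⊕ Q) : Prop := ∀ y, α x y ↔ β x y

/-- The point `x` lies in a common transversal of both partitions. -/
def Shared (α β : Setoid (P ⊕ Q)) (x : P ⊕ Q) : Prop := TrPt α x ∧ SameBlock α β x

/-- The point `x` is related to different points of its own side by both partitions. -/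
def Bad (α β : Setoid (P ⊕ Q)) (x : P ⊕ Q) : Prop :=
  ∃ y, x.isLeft = y.isLeft ∧ ¬ (α x y ↔ β x y)

variable {α β : Setoid (P ⊕ Q)} {x y : P ⊕ Q}

lemma SameBlock.congr (h : α x y) (hx : SameBlock α β x) : SameBlock α β y := fun z =>
  ⟨fun h' => β.trans (β.symm ((hx y).1 h)) ((hx z).1 (α.trans h h')),
    fun h' => α.trans (α.symm h) ((hx z).2 (β.trans ((hx y).1 h) h'))⟩

lemma Shared.congr (h : α x y) (hx : Shared α β x) : Shared α β y :=
  ⟨hx.1.congr h, hx.2.congr h⟩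

lemma shared_iff (h : α x y) : Shared α β x ↔ Shared α β y :=
  ⟨Shared.congr h, Shared.congr (α.symm h)⟩

lemma Shared.symm (hx : Shared α β x) : Shared β α x :=
  ⟨⟨hx.1.1.imp fun _ => (hx.2 _).1, hx.1.2.imp fun _ => (hx.2 _).1⟩, fun y => (hx.2 y).symm⟩

lemma shared_comm : Shared α β x ↔ Shared β α x := ⟨Shared.symm, Shared.symm⟩

lemma Bad.congr (h : α x y) (hs : x.isLeft = y.isLeft) (hx : Bad α β x) : Bad α β y := by
  by_contra hc
  obtain ⟨z, hz, hxz⟩ := hx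
  have hc' : ∀ z, y.isLeft = z.isLeft → (α y z ↔ β y z) := fun z hz =>
    by_contra fun h => hc ⟨z, hz, h⟩
  have hxy := (hc' x hs.symm).1 (α.symm h)
  refine hxz ⟨fun h' => ?_, fun h' => ?_⟩
  · exact β.trans (β.symm hxy) ((hc' z (hs.symm.trans hz)).1 (α.trans (α.symm h) h'))
  · exact α.trans h ((hc' z (hs.symm.trans hz)).2 (β.trans hxy h'))

lemma Bad.symm (hx : Bad α β x) : Bad β α x := by
  obtain ⟨y, h, h'⟩ := hx
  exact ⟨y, h, fun e => h' e.symm⟩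

lemma Bad.not_shared (hx : Bad α β x) : ¬ Shared α β x := by
  obtain ⟨y, -, h'⟩ := hx
  exact fun h => h' (h.2 y)

lemma shared_flip {x : Q ⊕ P} : Shared (flip α) (flip β) x ↔ Shared α β x.swap := by
  refine and_congr trPt_flip ⟨fun h y => ?_, fun h y => h y.swap⟩
  simpa using h y.swap

lemma bad_flip {x : Q ⊕ P} : Bad (flip α) (flip β) x ↔ Bad α β x.swap := by
  constructor
  · rintro ⟨y, h, h'⟩
    exact ⟨y.swap, by simpa using congrArg not h, h'⟩
  · rintro ⟨y, h, h'⟩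
    refine ⟨y.swap, ?_, by simpa using h'⟩
    rcases x with x | x <;> rcases y with y | y <;> simp at h ⊢

/-- The functions `a` and `b` choose points of all common transversals. -/
structure Common {J : Type u} (α β : Setoid (P ⊕ Q)) (a : J → P) (b : J → Q) : Prop where
  iff : ∀ i j, α (Sum.inl (a i)) (Sum.inr (b j)) ↔ i = j
  same : ∀ j, SameBlock α β (Sum.inl (a j))
  all : ∀ x, Shared α β x → ∃ j, α x (Sum.inl (a j))

variable (α β) in
lemma Common.exists : ∃ (J : Type u) (a : J → P) (b : J → Q), Common α β a b := by
  have h : ∀ c : {c : Quotient α // Shared α β c.out}, ∃ p q, α c.1.out (Sum.inl p) ∧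
      α c.1.out (Sum.inr q) := fun c => by
    obtain ⟨c, ⟨⟨p, hp⟩, q, hq⟩, -⟩ := c
    exact ⟨p, q, hp, hq⟩
  choose a b ha hb using h
  refine ⟨_, a, b, ⟨fun i j => ⟨fun h => ?_, ?_⟩, fun j => j.2.2.congr (ha j), fun x hx => ?_⟩⟩
  · refine Subtype.ext ?_
    rw [← Quotient.out_eq i.1, ← Quotient.out_eq j.1]
    exact Quotient.sound (α.trans (ha i) (α.trans h (α.symm (hb j))))
  · rintro rfl
    exact α.trans (α.symm (ha i)) (hb i)
  · have hx' : α x (⟦x⟧ : Quotient α).out := α.symm (Quotient.mk_out x)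
    exact ⟨⟨⟦x⟧, hx.congr hx'⟩, α.trans hx' (ha ⟨⟦x⟧, hx.congr hx'⟩)⟩

namespace Common
variable {J : Type u} {a : J → P} {b : J → Q}

lemma ab (C : Common α β a b) (j : J) : α (Sum.inl (a j)) (Sum.inr (b j)) := (C.iff j j).2 rfl

lemma shared (C : Common α β a b) (j : J) : Shared α β (Sum.inl (a j)) :=
  ⟨⟨⟨_, α.refl _⟩, _, C.ab j⟩, C.same j⟩

lemma injective (C : Common α β a b) : a.Injective := fun i j h => by
  have := C.ab j
  rwa [← h, C.iff] at this

protected lemma symm (C : Common α β a b) : Common β α a b where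
  iff i j := by
    rw [← C.iff, C.same]
  same j y := (C.same j y).symm
  all x hx := (C.all x hx.symm).imp fun j hj => (hx.symm.2 _).1 hj

protected lemma flip (C : Common α β a b) : Common (flip α) (flip β) b a where
  iff i j := by
    rw [eq_comm, ← C.iff]
    exact ⟨α.symm, α.symm⟩
  same j y := (C.same j).congr (C.ab j) y.swap
  all x hx := by
    obtain ⟨j, hj⟩ := C.all _ (shared_flip.1 hx)
    exact ⟨j, α.trans hj (C.ab j)⟩

lemma exists_label (C : Common α β a b) : ∃ t : P ⊕ Q → Option J,
    (∀ x, t x ≠ none ↔ Shared α β x) ∧ ∀ x j, t x = some j ↔ α x (Sum.inl (a j)) := by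
  have : ∀ x, ∃ t : Option J, (t ≠ none ↔ Shared α β x) ∧ ∀ j, t = some j ↔ α x (Sum.inl (a j)) := by
    intro x
    by_cases hx : Shared α β x
    · obtain ⟨j, hj⟩ := C.all x hx
      refine ⟨some j, by simpa using hx, fun k => ⟨fun h => ?_, fun h => ?_⟩⟩
      · rwa [← Option.some.inj h]
      · rw [← (C.iff j k).1 (α.trans (α.symm hj) (α.trans h (C.ab k)))]
    · refine ⟨none, by simpa using hx, fun k => ?_⟩
      simp only [reduceCtorEq, false_iff]
      exact fun h => hx ((C.shared k).congr (α.symm h))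
  choose t ht ht' using this
  exact ⟨t, ht, ht'⟩

/-- Removing the common transversals. -/
lemma rel_restrict {X : Type u} [Infinite X] {S : Sys X} {P' Q' : Type u}
    {J : Type u} {a : J → P} {b : J → Q}
    (hJ : #J ≤ #X) {γ γ' : Setoid (P ⊕ Q)} (hγ : ∀ i j, γ (Sum.inl (a i)) (Sum.inr (b j)) ↔ i = j)
    (hab : ∀ j, SameBlock γ γ' (Sum.inl (a j))) (f : P' → P) (g : Q' → Q)
    (hfg : ∀ x j, ¬ γ (Sum.map f g x) (Sum.inl (a j))) (H : S.rel γ γ') :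
    (S.shift J hJ).rel (Setoid.comap (Sum.map f g) γ) (Setoid.comap (Sum.map f g) γ') := by
  have key : ∀ δ : Setoid (P ⊕ Q), (∀ j, SameBlock γ δ (Sum.inl (a j))) →
      ext J (Setoid.comap (Sum.map f g) δ) =
        Setoid.comap (Sum.map (Sum.elim a f) (Sum.elim b g)) δ := by
    intro δ hδ
    have hb : ∀ j, δ (Sum.inl (a j)) (Sum.inr (b j)) := fun j => (hδ j _).1 ((hγ j j).2 rfl)
    have h1 : ∀ i j, δ (Sum.inl (a i)) (Sum.inl (a j)) ↔ i = j := fun i j =>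
      ⟨fun h => (hγ i j).1 ((hδ i _).2 (δ.trans h (hb j))), fun h => h ▸ δ.refl _⟩
    have h2 : ∀ x j, ¬ δ (Sum.map f g x) (Sum.inl (a j)) := fun x j h =>
      hfg x j (γ.symm ((hδ j _).2 (δ.symm h)))
    let e : (J ⊕ P') ⊕ (J ⊕ Q') → J ⊕ (P' ⊕ Q') :=
      Sum.elim (Sum.map id Sum.inl) (Sum.map id Sum.inr)
    have h3 : ∀ x, δ (Sum.map (Sum.elim a f) (Sum.elim b g) x)
        (Sum.elim (fun j => Sum.inl (a j)) (Sum.map f g) (e x)) := by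
      rintro ((x | x) | (x | x))
      · exact δ.refl _
      · exact δ.refl _
      · exact δ.symm (hb x)
      · exact δ.refl _
    ext x y
    have h4 : Setoid.comap (Sum.map (Sum.elim a f) (Sum.elim b g)) δ x y ↔
        δ (Sum.elim (fun j => Sum.inl (a j)) (Sum.map f g) (e x))
          (Sum.elim (fun j => Sum.inl (a j)) (Sum.map f g) (e y)) :=
      ⟨fun h => δ.trans (δ.symm (h3 x)) (δ.trans h (h3 y)),
        fun h => δ.trans (h3 x) (δ.trans h (δ.symm (h3 y)))⟩
    rw [h4, ext_def]
    change sumS _ _ (e x) (e y) ↔ _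
    rcases e x with x | x <;> rcases e y with y | y
    · simp [h1]
    · simpa using fun h => h2 y x (δ.symm h)
    · simpa using h2 x y
    · simp
  change S.rel _ _
  rw [key γ fun j => fun y => Iff.rfl, key γ' hab]
  exact S.comap _ _ H

end Common
end common

section
variable {P Q : Type u}

/-- The transversals of `α` which are not blocks of `β`. -/
abbrev Unshared (α β : Setoid (P ⊕ Q)) : Type u :=
  {c : Quotient α // TrPt α c.out ∧ ¬ SameBlock α β c.out}

/-- The upper blocks of `α` on which `α` and `β` differ. -/
abbrev BadTop (α β : Setoid (P ⊕ Q)) : Type u :=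
  {c : Quotient (Setoid.comap Sum.inl α) // Bad α β (Sum.inl c.out)}

/-- Splitting all unshared transversals. -/
def cut (α β : Setoid (P ⊕ Q)) : Setoid (P ⊕ Q) :=
  Setoid.ker fun x => ((⟦x⟧ : Quotient α), (Shared α β x ∨ x.isLeft))

open Classical in
/-- Splitting all unshared transversals and merging the bad upper blocks. -/
noncomputable def cutTop (α β : Setoid (P ⊕ Q)) : Setoid (P ⊕ Q) :=
  Setoid.ker fun x => ((if Bad α β x ∧ x.isLeft then none else some (⟦x⟧ : Quotient α)),
    (Shared α β x ∨ x.isLeft))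

open Classical in
/-- Splitting all unshared transversals and merging the bad blocks on either side. -/
noncomputable def cutBoth (α β : Setoid (P ⊕ Q)) : Setoid (P ⊕ Q) :=
  Setoid.ker fun x => ((if Bad α β x then none else some (⟦x⟧ : Quotient α)),
    (Shared α β x ∨ x.isLeft))

variable {α β : Setoid (P ⊕ Q)}

lemma side_iff {x y : P ⊕ Q} (h : Shared α β x ↔ Shared α β y) :
    (Shared α β x ∨ x.isLeft) = (Shared α β y ∨ y.isLeft) ↔
      x.isLeft = y.isLeft ∨ Shared α β x := by
  rcases x with x | x <;> rcases y with y | y <;> simp [h]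

lemma cut_rel (x y : P ⊕ Q) : cut α β x y ↔ α x y ∧ (x.isLeft = y.isLeft ∨ Shared α β x) := by
  unfold cut
  rw [Setoid.ker_def, Prod.mk.injEq, Quotient.eq]
  exact and_congr_right fun h => side_iff (shared_iff h)

lemma cutTop_rel (x y : P ⊕ Q) : cutTop α β x y ↔
    cut α β x y ∨ (Bad α β x ∧ x.isLeft) ∧ (Bad α β y ∧ y.isLeft) := by
  have h1 : α x y → x.isLeft = y.isLeft → (Bad α β x ↔ Bad α β y) := fun h h' =>
    ⟨Bad.congr h h', Bad.congr (α.symm h) h'.symm⟩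
  have h2 := @Bad.not_shared _ _ α β x
  have h3 := @Bad.not_shared _ _ α β y
  have h4 : α x y → (Shared α β x ↔ Shared α β y) := shared_iff
  rw [cut_rel]
  unfold cutTop
  rw [Setoid.ker_def, Prod.mk.injEq]
  by_cases hx : Bad α β x ∧ x.isLeft <;> by_cases hy : Bad α β y ∧ y.isLeft
  · simp [hx, hy]
  · simp only [hx, hy, if_true, if_false, reduceCtorEq, false_and, and_false, or_false, false_iff,
      and_self]
    grind
  · simp only [hx, hy, if_true, if_false, reduceCtorEq, false_and, and_false, or_false, false_iff,
      and_self]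
    grind
  · simp only [hx, hy, if_false, and_false, or_false, Option.some.injEq, Quotient.eq]
    exact and_congr_right fun h => side_iff (h4 h)

lemma cutBoth_rel (x y : P ⊕ Q) : cutBoth α β x y ↔
    cut α β x y ∨ Bad α β x ∧ Bad α β y ∧ x.isLeft = y.isLeft := by
  have h1 : α x y → x.isLeft = y.isLeft → (Bad α β x ↔ Bad α β y) := fun h h' =>
    ⟨Bad.congr h h', Bad.congr (α.symm h) h'.symm⟩
  have h2 := @Bad.not_shared _ _ α β x
  have h3 := @Bad.not_shared _ _ α β y
  have h4 : α x y → (Shared α β x ↔ Shared α β y) := shared_iff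
  rw [cut_rel]
  unfold cutBoth
  rw [Setoid.ker_def, Prod.mk.injEq]
  by_cases hx : Bad α β x <;> by_cases hy : Bad α β y
  · have := @side_iff _ _ α β x y (by tauto)
    rw [if_pos hx, if_pos hy, this]
    tauto
  · simp only [hx, hy, if_true, if_false, reduceCtorEq, false_and, and_false, or_false, false_iff,
      and_self]
    grind
  · simp only [hx, hy, if_true, if_false, reduceCtorEq, false_and, and_false, or_false, false_iff,
      and_self]
    grind
  · simp only [hx, hy, if_false, false_and, or_false, Option.some.injEq, Quotient.eq]
    exact and_congr_right fun h => side_iff (h4 h)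

lemma cut_flip : cut (flip α) (flip β) = flip (cut α β) := by
  ext x y
  simp only [flip_rel, cut_rel, shared_flip]
  rcases x with x | x <;> rcases y with y | y <;> simp

lemma cutBoth_comm : cutBoth α β = cutBoth β α := by
  have key : ∀ {α β : Setoid (P ⊕ Q)} {x y : P ⊕ Q}, cutBoth α β x y → cutBoth β α x y := by
    intro α β x y h
    rw [cutBoth_rel, cut_rel] at h ⊢
    rcases h with ⟨h, h' | h'⟩ | ⟨h, h', h''⟩
    · by_cases hx : Bad α β x
      · exact Or.inr ⟨hx.symm, (hx.congr h h').symm, h'⟩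
      · refine Or.inl ⟨?_, Or.inl h'⟩
        by_contra hc
        exact hx ⟨y, h', fun e => hc (e.1 h)⟩
    · exact Or.inl ⟨(h'.2 y).1 h, Or.inr h'.symm⟩
    · exact Or.inr ⟨h.symm, h'.symm, h''⟩
  ext x y
  exact ⟨key, key⟩

end

namespace Sys
variable {X : Type u} {S : Sys X} {P Q J : Type u} {α β : Setoid (P ⊕ Q)} {a : J → P} {b : J → Q}

lemma rel_cut (C : Common α β a b) (h : S.SplitIn J (Unshared α β)) : S.rel α (cut α β) := by
  classical
  obtain ⟨t, ht, ht'⟩ := C.exists_label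
  have hm : ∀ x, α x (⟦x⟧ : Quotient α).out := fun x => α.symm (Quotient.mk_out x)
  have hs : ∀ x, ∃ s : Option (Unshared α β), (s ≠ none ↔ TrPt α x ∧ ¬ SameBlock α β x) ∧
      ∀ i, s = some i ↔ i.1 = ⟦x⟧ := by
    intro x
    by_cases hx : TrPt α x ∧ ¬ SameBlock α β x
    · refine ⟨some ⟨⟦x⟧, hx.1.congr (hm x), fun h => hx.2 (h.congr (Quotient.mk_out x))⟩,
        by simpa using hx, fun i => ?_⟩
      simp [Subtype.ext_iff, eq_comm]
    · refine ⟨none, by simpa using hx, fun i => ?_⟩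
      simp only [reduceCtorEq, false_iff]
      intro hi
      have hix : α i.1.out x := by
        rw [hi]
        exact Quotient.mk_out x
      exact hx ⟨i.2.1.congr hix, fun h => i.2.2 (h.congr (α.symm hix))⟩
  choose s hs hs' using hs
  refine rel_of_splitIn h t s ?_ ?_ ?_ ?_ ?_ ?_ ?_
  · intro x y hxy
    refine Option.ext fun j => ?_
    rw [ht', ht']
    exact ⟨fun h => α.trans (α.symm hxy) h, fun h => α.trans hxy h⟩
  · intro x y j hx hy
    exact α.trans ((ht' x j).1 hx) (α.symm ((ht' y j).1 hy))
  · intro x y hxy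
    refine Option.ext fun j => ?_
    have : (⟦x⟧ : Quotient α) = ⟦y⟧ := Quotient.sound hxy
    rw [hs', hs', this]
  · intro x y j hx hy
    exact Quotient.exact (((hs' x j).1 hx).symm.trans ((hs' y j).1 hy))
  · intro x i hi
    by_contra hc
    have := (hs x).1 (by simp [hi])
    exact this.2 ((ht x).1 hc).2
  · intro p q hpq h0
    refine (hs _).2 ⟨⟨⟨p, α.refl _⟩, q, hpq⟩, fun h => ?_⟩
    exact (ht _).2 ⟨⟨⟨p, α.refl _⟩, q, hpq⟩, h⟩ h0
  · intro x y
    rw [cut_rel, ht]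

lemma mergeIn_of_cut [Infinite X] (C : Common α β a b) (hP : #P ≤ #X)
    (H : S.rel (cut α β) (cut β α)) : S.MergeIn J (BadTop α β) := by
  have hJ : #J ≤ #X := (Cardinal.mk_le_of_injective C.injective).trans hP
  have h1 := Common.rel_restrict (a := a) (b := b) hJ (γ := cut α β) (γ' := cut β α) ?_ ?_
    (fun v : {p // ¬ Shared α β (Sum.inl p)} => v.1) (PEmpty.elim : PEmpty.{u + 1} → Q) ?_ H
  · have e : ∀ γ : Setoid (P ⊕ Q), Setoid.comap (Sum.map
        (fun v : {p // ¬ Shared α β (Sum.inl p)} => v.1) (PEmpty.elim : PEmpty.{u + 1} → Q)) γ =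
        sumS (Setoid.comap (fun v : {p // ¬ Shared α β (Sum.inl p)} => Sum.inl v.1) γ) ⊥ := by
      intro γ
      ext x y
      rcases x with x | ⟨⟨⟩⟩
      rcases y with y | ⟨⟨⟩⟩
      simp
    rw [e, e] at h1
    have hz : ∀ n : BadTop α β, ∃ z : P, Bad α β (Sum.inl z) ∧
        ¬ (α (Sum.inl n.1.out) (Sum.inl z) ↔ β (Sum.inl n.1.out) (Sum.inl z)) := by
      rintro ⟨n, z, hz, h⟩
      rcases z with z | z
      · exact ⟨z, ⟨Sum.inl n.out, rfl, fun e => h ⟨fun h => β.symm (e.1 (α.symm h)),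
          fun h => α.symm (e.2 (β.symm h))⟩⟩, h⟩
      · simp at hz
    choose z hz hz' using hz
    refine mrg_of_changed (S := S.shift J hJ) ((Cardinal.mk_subtype_le _).trans hP) h1
      (fun n : BadTop α β => ⟨n.1.out, n.2.not_shared⟩) (fun n => ⟨z n, (hz n).not_shared⟩) ?_ ?_
    · intro n m h
      simp only [comap_rel, cut_rel] at h
      refine Subtype.ext ?_
      rw [← Quotient.out_eq n.1, ← Quotient.out_eq m.1]
      exact Quotient.sound h.1
    · intro n
      simpa [cut_rel] using hz' n
  · intro i j
    rw [cut_rel, C.iff]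
    exact and_iff_left_of_imp fun _ => Or.inr (C.shared i)
  · intro j y
    rw [cut_rel, cut_rel, C.same, ← shared_comm (α := α)]
  · rintro (x | ⟨⟨⟩⟩) j h
    rw [cut_rel] at h
    exact x.2 ((C.shared j).congr (α.symm h.1))

lemma exists_bad_label {P Q : Type u} (α β : Setoid (P ⊕ Q)) :
    ∃ s : P → Option (BadTop α β), (∀ p, s p ≠ none ↔ Bad α β (Sum.inl p)) ∧
      ∀ p i, s p = some i ↔ i.1 = ⟦p⟧ := by
  have : ∀ p, ∃ s : Option (BadTop α β), (s ≠ none ↔ Bad α β (Sum.inl p)) ∧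
      ∀ i, s = some i ↔ i.1 = ⟦p⟧ := by
    intro p
    have hm : α (Sum.inl (⟦p⟧ : Quotient (Setoid.comap Sum.inl α)).out) (Sum.inl p) :=
      Quotient.mk_out (s := Setoid.comap Sum.inl α) p
    by_cases hp : Bad α β (Sum.inl p)
    · refine ⟨some ⟨⟦p⟧, hp.congr (α.symm hm) rfl⟩, by simpa using hp, fun i => ?_⟩
      simp [Subtype.ext_iff, eq_comm]
    · refine ⟨none, by simpa using hp, fun i => ?_⟩
      simp only [reduceCtorEq, false_iff]
      intro hi
      exact hp (Bad.congr hm rfl (hi ▸ i.2))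
  choose s hs hs' using this
  exact ⟨s, hs, hs'⟩

/-- Merging bad upper blocks in a partition lying between `cut α β` and `cutBoth α β`. -/
lemma rel_merge (C : Common α β a b) (h : S.MergeIn J (BadTop α β)) {γ γ' : Setoid (P ⊕ Q)}
    (hs : ∀ x, Shared α β x → SameBlock α γ x)
    (hl : ∀ p p', γ (Sum.inl p) (Sum.inl p') ↔ α (Sum.inl p) (Sum.inl p'))
    (hc : ∀ p q, γ (Sum.inl p) (Sum.inr q) → Shared α β (Sum.inl p))
    (hγ' : ∀ x y, γ' x y ↔ γ x y ∨ (Bad α β x ∧ x.isLeft) ∧ (Bad α β y ∧ y.isLeft)) :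
    S.rel γ γ' := by
  obtain ⟨t, ht, ht'⟩ := C.exists_label
  obtain ⟨s, hs1, hs2⟩ := exists_bad_label α β
  have htγ : ∀ x j, t x = some j ↔ γ x (Sum.inl (a j)) := by
    intro x j
    rw [ht']
    have := hs _ (C.shared j) x
    exact ⟨fun h => γ.symm (this.1 (α.symm h)), fun h => α.symm (this.2 (γ.symm h))⟩
  refine rel_of_mergeIn h t (Sum.elim s fun _ => none) ?_ ?_ ?_ ?_ ?_ ?_ ?_ ?_
  · intro x y hxy
    refine Option.ext fun j => ?_
    rw [htγ, htγ]
    exact ⟨fun h => γ.trans (γ.symm hxy) h, fun h => γ.trans hxy h⟩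
  · intro x y j hx hy
    exact γ.trans ((htγ x j).1 hx) (γ.symm ((htγ y j).1 hy))
  · intro p p' hpp
    refine Option.ext fun j => ?_
    have : (⟦p⟧ : Quotient (Setoid.comap Sum.inl α)) = ⟦p'⟧ := Quotient.sound ((hl _ _).1 hpp)
    rw [Sum.elim_inl, Sum.elim_inl, hs2, hs2, this]
  · rintro (x | x) (y | y) j hx hy <;> simp only [Sum.elim_inl, Sum.elim_inr, reduceCtorEq] at hx hy
    have e : (⟦x⟧ : Quotient (Setoid.comap Sum.inl α)) = ⟦y⟧ :=
      ((hs2 x j).1 hx).symm.trans ((hs2 y j).1 hy)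
    have e' : Setoid.comap Sum.inl α x y := Quotient.exact e
    exact (hl _ _).2 e'
  · rintro (x | x) i hi <;> simp only [Sum.elim_inl, Sum.elim_inr, reduceCtorEq] at hi
    by_contra hc
    exact ((hs1 x).1 (by simp [hi])).not_shared ((ht _).1 hc)
  · simp
  · intro p q hpq
    exact (ht _).2 (hc p q hpq)
  · have : ∀ x : P ⊕ Q, Sum.elim s (fun _ => none) x ≠ none ↔ Bad α β x ∧ x.isLeft := by
      rintro (x | x)
      · simpa using hs1 x
      · simp
    intro x y
    rw [hγ', this, this]

lemma rel_cutBoth (C : Common α β a b) (h : S.MergeIn J (BadTop α β))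
    (h' : S.dual.MergeIn J (BadTop (flip α) (flip β))) : S.rel (cut α β) (cutBoth α β) := by
  have h1 : S.rel (cut α β) (cutTop α β) := by
    refine rel_merge C h ?_ ?_ ?_ fun x y => cutTop_rel x y
    · intro x hx y
      rw [cut_rel]
      tauto
    · intro p p'
      simp [cut_rel]
    · intro p q h
      simpa [cut_rel] using (cut_rel _ _).1 h |>.2
  refine S.trans h1 ?_
  have h2 : S.dual.rel (flip (cutTop α β)) (flip (cutBoth α β)) := by
    refine rel_merge C.flip h' ?_ ?_ ?_ ?_
    · intro x hx y
      rw [shared_flip] at hx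
      have := @Bad.not_shared _ _ α β x.swap
      rw [flip_rel, flip_rel, cutTop_rel, cut_rel]
      tauto
    · intro p p'
      rw [flip_rel, flip_rel, cutTop_rel, cut_rel]
      simp
    · intro p q h
      rw [flip_rel, cutTop_rel, cut_rel] at h
      rw [shared_flip]
      have h' : α (Sum.inr p) (Sum.inl q) ∧ Shared α β (Sum.inr p) := by simpa using h
      exact h'.2
    · intro x y
      simp only [flip_rel, cutTop_rel, cutBoth_rel, bad_flip]
      rcases x with x | x <;> rcases y with y | y <;> simp
  change S.rel (flip (flip _)) (flip (flip _)) at h2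
  simpa using h2

end Sys

namespace Sys
variable {X : Type u} {S : Sys X} {P Q J I : Type u}

/-- The index of a point of `ext J (eT I)`. -/
def idx : (J ⊕ I) ⊕ (J ⊕ I) → J ⊕ I := Sum.elim id id

lemma ext_eT_rel (x y : (J ⊕ I) ⊕ (J ⊕ I)) : ext J (eT I) x y ↔ idx x = idx y := by
  rcases x with (x | x) | (x | x) <;> rcases y with (y | y) | (y | y) <;> simp [ext_def, idx]

lemma ext_bot_rel (x y : (J ⊕ I) ⊕ (J ⊕ I)) : ext J (⊥ : Setoid (I ⊕ I)) x y ↔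
    idx x = idx y ∧ (x.isLeft = y.isLeft ∨ (idx x).isLeft) := by
  rcases x with (x | x) | (x | x) <;> rcases y with (y | y) | (y | y) <;> simp [ext_def, idx]

lemma splitIn_of_isEmpty [IsEmpty I] : S.SplitIn J I := by
  have : eT I = ⊥ := by
    ext x
    rcases x with x | x <;> exact isEmptyElim x
  unfold SplitIn
  rw [this]
  exact S.refl _

lemma splitIn_of_col (h : S.Col (J ⊕ I)) : S.SplitIn J I := by
  have h1 := split_of_col h (ω := ext J (eT I)) idx fun x y _ _ => (ext_eT_rel x y).symm
  have h2 := split_of_col h (ω := ext J (⊥ : Setoid (I ⊕ I))) idx fun x y hx hy => by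
    have key : ∀ x : (J ⊕ I) ⊕ (J ⊕ I), TrPt (ext J (⊥ : Setoid (I ⊕ I))) x → (idx x).isLeft := by
      rintro x ⟨⟨p, hp⟩, q, hq⟩
      rw [ext_bot_rel] at hp hq
      rcases x with x | x <;> simp at hp hq <;> tauto
    rw [ext_bot_rel]
    simp [key x hx]
  refine S.trans h1 (S.symm ?_)
  convert h2 using 2 <;> ext x y <;> simp only [comap_rel, ext_eT_rel, ext_bot_rel] <;> simp

lemma SplitIn.option (h₁ : S.SplitIn (J ⊕ I) PUnit.{u + 1}) (h₂ : S.SplitIn J I) :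
    S.SplitIn J (Option I) := by
  let γ : Setoid ((J ⊕ Option I) ⊕ (J ⊕ Option I)) :=
    Setoid.ker fun x => (idx x, (idx x = Sum.inr none → x.isLeft))
  have hγ : ∀ x y, γ x y ↔ idx x = idx y ∧ (x.isLeft = y.isLeft ∨ idx x ≠ Sum.inr none) := by
    intro x y
    simp only [γ, Setoid.ker_def, Prod.mk.injEq]
    refine and_congr_right fun h => ?_
    rw [← h]
    by_cases h : idx x = Sum.inr none <;> simp [h, ← Bool.eq_iff_iff]
  refine S.trans (ω' := γ) ?_ ?_
  · refine rel_of_splitIn h₁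
      (fun x => (idx x).elim (fun j => some (Sum.inl j)) fun o => o.map Sum.inr)
      (fun x => (idx x).elim (fun _ => none) fun o => o.elim (some PUnit.unit) fun _ => none)
      ?_ ?_ ?_ ?_ ?_ ?_ ?_
    all_goals
      intro x
      try intro y
      try simp only [ext_eT_rel, hγ]
    · exact fun h => by rw [h]
    · rcases idx x with i | _ | i <;> rcases idx y with j | _ | j <;> simp <;> grind
    · exact fun h => by rw [h]
    · rcases idx x with i | _ | i <;> rcases idx y with j | _ | j <;> simp
    · rcases idx x with i | _ | i <;> rintro ⟨⟩
      rfl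
    · rcases x with i | _ | i <;> simp [idx]
    · rcases idx x with i | _ | i <;> simp
  · refine rel_of_splitIn h₂
      (fun x => (idx x).elim some fun _ => none)
      (fun x => (idx x).elim (fun _ => none) id)
      ?_ ?_ ?_ ?_ ?_ ?_ ?_
    all_goals
      intro x
      try intro y
      try simp only [ext_bot_rel, hγ]
    · exact fun h => by rw [h.1]
    · rcases idx x with i | _ | i <;> rcases idx y with j | _ | j <;> simp
      grind
    · exact fun h => by rw [h.1]
    · rcases idx x with i | _ | i <;> rcases idx y with j | _ | j <;> simp
      grind
    · rcases idx x with i | _ | i <;> simp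
    · rcases x with i | _ | i <;> simp [idx]
    · rcases idx x with i | _ | i <;> simp

lemma SplitIn.of_finite [Infinite J] (h : S.SplitIn J PUnit.{u + 1}) [Finite I] :
    S.SplitIn J I := by
  induction I using Finite.induction_empty_option with
  | of_equiv e ih => exact ih.of_le le_rfl (Cardinal.mk_congr e).ge
  | h_empty => exact splitIn_of_isEmpty
  | @h_option I _ ih =>
    refine SplitIn.option (h.of_le ?_ le_rfl) ih
    rw [← Cardinal.add_def]
    exact Cardinal.add_le_of_le (Cardinal.aleph0_le_mk J) le_rfl
      (Cardinal.mk_le_aleph0.trans (Cardinal.aleph0_le_mk J))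

variable {α β : Setoid (P ⊕ Q)} {a : J → P} {b : J → Q}

lemma splitIn_or_exc [Infinite X] (C : Common α β a b) (hP : #P ≤ #X) (hQ : #Q ≤ #X)
    (H : S.rel α β) : S.SplitIn J (Unshared α β) ∨ S.Exc α β := by
  have hJ : #J ≤ #X := (Cardinal.mk_le_of_injective C.injective).trans hP
  have hm : ∀ x, α x (⟦x⟧ : Quotient α).out := fun x => α.symm (Quotient.mk_out x)
  have hpq : ∀ i : Unshared α β, ∃ p q, α i.1.out (Sum.inl p) ∧ α i.1.out (Sum.inr q) := by
    rintro ⟨i, ⟨⟨p, hp⟩, q, hq⟩, -⟩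
    exact ⟨p, q, hp, hq⟩
  choose p q hp hq using hpq
  have hii : ∀ i j, α i.1.out (Sum.inl (p j)) ↔ i = j := by
    refine fun i j => ⟨fun h => Subtype.ext ?_, fun h => h ▸ hp i⟩
    rw [← Quotient.out_eq i.1, ← Quotient.out_eq j.1]
    exact Quotient.sound (α.trans h (α.symm (hp j)))
  have hiff : ∀ i j, α (Sum.inl (p i)) (Sum.inr (q j)) ↔ i = j := by
    refine fun i j => ⟨fun h => ?_, ?_⟩
    · rw [eq_comm, ← hii]
      exact α.trans (hq j) (α.symm h)
    · rintro rfl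
      exact α.trans (α.symm (hp i)) (hq i)
  have hsame : ∀ i, ¬ SameBlock α β (Sum.inl (p i)) := fun i h => i.2.2 (h.congr (α.symm (hp i)))
  have hI : #(Unshared α β) ≤ #X := (Cardinal.mk_le_of_injective (f := p) fun i j h => by
    rw [← hii, ← h]; exact hp i).trans hP
  have h1 := Common.rel_restrict hJ C.iff C.same
    (fun v : {p // ¬ Shared α β (Sum.inl p)} => v.1)
    (fun w : {q // ¬ Shared α β (Sum.inr q)} => w.1) (fun x j h => by
      rcases x with x | x
      · exact x.2 ((C.shared j).congr (α.symm h))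
      · exact x.2 ((C.shared j).congr (α.symm h))) H
  have hpV : ∀ i, ¬ Shared α β (Sum.inl (p i)) := fun i h => hsame i h.2
  have hqV : ∀ i, ¬ Shared α β (Sum.inr (q i)) := fun i h =>
    hpV i (h.congr (α.symm ((hiff i i).2 rfl)))
  have hnon : ∀ i, ∃ x : {p // ¬ Shared α β (Sum.inl p)} ⊕ {q // ¬ Shared α β (Sum.inr q)},
      ¬ (Setoid.comap (Sum.map (fun v => v.1) (fun w => w.1)) α (Sum.inl ⟨p i, hpV i⟩) x ↔
        Setoid.comap (Sum.map (fun v => v.1) (fun w => w.1)) β (Sum.inl ⟨p i, hpV i⟩) x) := by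
    intro i
    by_contra hc
    push Not at hc
    refine hsame i fun y => ?_
    by_cases hy : Shared α β y
    · rw [show α (Sum.inl (p i)) y ↔ α y (Sum.inl (p i)) from ⟨α.symm, α.symm⟩, hy.2 _]
      exact ⟨β.symm, β.symm⟩
    · rcases y with y | y
      · exact hc (Sum.inl ⟨y, hy⟩)
      · exact hc (Sum.inr ⟨y, hy⟩)
  rcases finite_or_infinite (Unshared α β) with hfin | hinf
  swap
  · exact Or.inl (col_of_noncommon hI h1 (a := fun i => ⟨p i, hpV i⟩) (b := fun i => ⟨q i, hqV i⟩)
      hiff hnon)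
  rcases isEmpty_or_nonempty (Unshared α β) with hemp | ⟨⟨i₀⟩⟩
  · exact Or.inl splitIn_of_isEmpty
  rcases finite_or_infinite J with hJfin | hJinf
  swap
  · have h2 : (S.shift J hJ).Col PUnit.{u + 1} := col_unit_of_noncommon
      (Cardinal.one_le_iff_ne_zero.2 (Cardinal.mk_ne_zero X)) h1 (p₀ := ⟨p i₀, hpV i₀⟩)
      (q₀ := ⟨q i₀, hqV i₀⟩) ((hiff i₀ i₀).2 rfl) (hnon i₀)
    exact Or.inl (SplitIn.of_finite h2)
  by_cases hcol : S.Col (J ⊕ Unshared α β)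
  · exact Or.inl (splitIn_of_col hcol)
  have F : S.FinFam α β (Sum.elim a p) (Sum.elim b q) := by
    refine ⟨H, ?_, ?_, hcol, hP, hQ⟩
    · rintro (i | i) (j | j)
      · simpa using C.iff i j
      · simp only [Sum.elim_inl, Sum.elim_inr, reduceCtorEq, iff_false]
        exact fun h => hqV j ((C.shared i).congr h)
      · simp only [Sum.elim_inl, Sum.elim_inr, reduceCtorEq, iff_false]
        exact fun h => hpV i ((C.shared j).congr (α.trans (C.ab j) (α.symm h)))
      · simpa using hiff i j
    · intro x hx
      by_cases hs : SameBlock α β x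
      · obtain ⟨j, hj⟩ := C.all x ⟨hx, hs⟩
        exact ⟨Sum.inl j, hj⟩
      · let i : Unshared α β := ⟨⟦x⟧, hx.congr (hm x), fun h => hs (h.congr (α.symm (hm x)))⟩
        exact ⟨Sum.inr i, α.trans (hm x) (hp i)⟩
  exact Or.inr (F.exc (Sum.inr i₀))

/-- The data determining whether two partitions are related, up to exceptional pairs. -/
def Feat (S : Sys X) (J : Type u) (α β : Setoid (P ⊕ Q)) : Prop :=
  S.SplitIn J (Unshared α β) ∧ S.MergeIn J (BadTop α β) ∧
    S.dual.MergeIn J (BadTop (flip α) (flip β))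

lemma feat [Infinite X] (C : Common α β a b) (hP : #P ≤ #X) (hQ : #Q ≤ #X) (H : S.rel α β)
    (h : S.SplitIn J (Unshared α β)) (h' : S.SplitIn J (Unshared β α)) : S.Feat J α β := by
  have h1 : S.rel (cut α β) (cut β α) :=
    S.trans (S.symm (rel_cut C h)) (S.trans H (rel_cut C.symm h'))
  refine ⟨h, mergeIn_of_cut C hP h1, mergeIn_of_cut C.flip hQ ?_⟩
  rw [cut_flip, cut_flip]
  exact dual_rel h1

lemma rel_of_feat (C : Common α β a b) (h : S.Feat J α β) (h' : S.Feat J β α) : S.rel α β := by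
  have key : ∀ {α β : Setoid (P ⊕ Q)}, Common α β a b → S.Feat J α β → S.rel α (cutBoth α β) :=
    fun C h => S.trans (rel_cut C h.1) (rel_cutBoth C h.2.1 h.2.2)
  refine S.trans (key C h) (S.symm ?_)
  rw [cutBoth_comm]
  exact key C.symm h'

lemma rel_of_col {N : Type u} {ω : Setoid (N ⊕ N)} (h : S.Col N)
    (hl : ∀ i j, ω (Sum.inl i) (Sum.inl j) → i = j)
    (hr : ∀ i j, ω (Sum.inr i) (Sum.inr j) → i = j) : S.rel (eT N) ω := by
  have key : ∀ x : N ⊕ N, TrPt ω x → ∃ i, ω x (Sum.inl i) := fun x hx => hx.1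
  have hl' : ∀ i j, ω (Sum.inl i) (Sum.inl j) ↔ i = j :=
    fun i j => ⟨hl i j, fun h => h ▸ ω.refl _⟩
  choose t ht using fun x : N ⊕ N => show ∃ i : N, TrPt ω x → ω x (Sum.inl i) by
    by_cases hx : TrPt ω x
    · exact hx.1.imp fun i hi _ => hi
    · rcases x with x | x <;> exact ⟨x, fun h => absurd h hx⟩
  have h1 := split_of_col h (ω := ω) t fun x y hx hy => by
    rw [← hl']
    exact ⟨fun h => ω.trans (ht x hx) (ω.trans h (ω.symm (ht y hy))),
      fun h => ω.trans (ω.symm (ht x hx)) (ω.trans h (ht y hy))⟩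
  refine S.trans h (S.symm ?_)
  convert h1 using 1
  ext x y
  rcases x with x | x <;> rcases y with y | y <;> simp [hl']
  exact ⟨fun h => h ▸ ω.refl _, hr x y⟩

lemma col_of_lt [Infinite X] {N M : Type u} [Finite N] {ω : Setoid (N ⊕ N)}
    (H : S.rel (eT N) ω) (hl : ∀ i j, ω (Sum.inl i) (Sum.inl j) → i = j)
    (hr : ∀ i j, ω (Sum.inr i) (Sum.inr j) → i = j) (hne : ω ≠ eT N) (hcol : ¬ S.Col N)
    (hM : #M < #N) : S.Col M := by
  classical
  have h1 : ∃ i, ¬ ω (Sum.inl i) (Sum.inr i) := by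
    by_contra hc
    push Not at hc
    refine hne ?_
    have := eq_eT (ω := ω) (a := id) (b := id) fun i j =>
      ⟨fun h => hl i j (ω.trans h (ω.symm (hc j))), fun h => h ▸ hc i⟩
    rwa [Sum.map_id_id, Setoid.comap_id] at this
  obtain ⟨i, hi⟩ := h1
  obtain ⟨j, hj⟩ : ∃ j, ω (Sum.inl i) (Sum.inr j) := by
    by_contra hc
    push Not at hc
    exact hcol (col_of_free_top (mk_le_of_finite N) H i hc)
  have hij : i ≠ j := by
    rintro rfl
    exact hi hj
  have h2 := S.comap (fun x : {x // x ≠ j} => x.1) (fun x : {x // x ≠ j} => x.1) H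
  rw [comap_eT Subtype.val_injective] at h2
  have h3 := col_of_free_top (mk_le_of_finite _) h2 ⟨i, hij⟩ fun k hk =>
    k.2 (hr _ _ (ω.trans (ω.symm hk) hj))
  refine h3.of_le ?_
  have h4 : #N = #{x // x ≠ j} + 1 := by
    rw [← Cardinal.mk_option]
    exact Cardinal.mk_congr (Equiv.optionSubtypeNe j).symm
  rw [h4] at hM
  exact le_of_not_gt fun h => (Cardinal.add_one_le_of_lt h).not_gt hM

/-- The exceptional relations of `S` are contained in those of `S'`. -/
def ExcLe (S S' : Sys X) : Prop :=
  ∀ (n : ℕ) (ω : Setoid (ULift.{u} (Fin n) ⊕ ULift.{u} (Fin n))), ¬ S.Col (ULift.{u} (Fin n)) →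
    S.rel (eT _) ω → (∀ i j, ω (Sum.inl i) (Sum.inl j) → i = j) →
    (∀ i j, ω (Sum.inr i) (Sum.inr j) → i = j) → S'.rel (eT _) ω

lemma rel_of_exc {S' : Sys X} (h : ExcLe S S') (H : S.Exc α β) : S'.rel α β := by
  obtain ⟨N, Z, Z', hN, ω, f, k, rfl, rfl, H, hcol, hl, hr⟩ := H
  refine S'.cmap f k ?_
  obtain ⟨n, ⟨e⟩⟩ := Finite.exists_equiv_fin N
  let e' : N ≃ ULift.{u} (Fin n) := e.trans Equiv.ulift.symm
  have h1 := S.comap e'.symm e'.symm H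
  rw [comap_eT e'.symm.injective] at h1
  have h2 := h n _ (fun h => hcol (h.mono e'.injective)) h1
    (fun i j h => e'.symm.injective (hl _ _ h)) fun i j h => e'.symm.injective (hr _ _ h)
  have h3 := S'.comap e' e' h2
  rw [comap_eT e'.injective] at h3
  convert h3 using 1
  ext x y
  simp

end Sys

section wqo
variable {A : Type*} [LinearOrder A]

instance wellFoundedLT_lowerSet [WellFoundedLT A] : WellFoundedLT (LowerSet A) := by
  refine ⟨RelEmbedding.wellFounded_iff_isEmpty.2 ⟨fun f => ?_⟩⟩
  have h : ∀ n, ∃ x, x ∈ f n ∧ x ∉ f (n + 1) := fun n =>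
    Set.not_subset.1 (f.map_rel_iff.2 (Nat.lt_succ_self n) : f (n + 1) < f n).not_ge
  choose x hx hx' using h
  refine not_strictAnti_of_wellFoundedLT x (strictAnti_nat_of_succ_lt fun n => ?_)
  exact lt_of_not_ge fun h => hx' n ((f (n + 1)).lower h (hx (n + 1)))

/-- The vertical section of a lower set. -/
def sect (D : LowerSet (A × A)) (a : A) : LowerSet A :=
  ⟨{b | (a, b) ∈ D}, fun _ _ h h' => D.lower (Prod.mk_le_mk.2 ⟨le_rfl, h⟩) h'⟩

lemma sect_antitone (D : LowerSet (A × A)) : Antitone (sect D) :=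
  fun _ _ h _ h' => D.lower (Prod.mk_le_mk.2 ⟨h, le_rfl⟩) h'

lemma finite_range_sect [WellFoundedLT A] (D : LowerSet (A × A)) :
    (Set.range (sect D)).Finite := by
  by_contra hc
  have : Infinite (Set.range (sect D)) := Set.infinite_coe_iff.2 hc
  obtain ⟨f, hf | hf⟩ := Infinite.exists_strictMono_or_strictAnti (Set.range (sect D))
  · choose g hg using fun n => (f n).2
    refine not_strictAnti_of_wellFoundedLT g fun m n h => lt_of_not_ge fun h' => ?_
    have := sect_antitone D h'
    rw [hg, hg] at this
    exact (hf h).not_ge this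
  · exact not_strictAnti_of_wellFoundedLT (fun n => (f n).1) fun m n h => hf h

/-- The union of a list of rectangles. -/
def rectUnion (l : List (LowerSet A × LowerSet A)) : Set (A × A) :=
  {c | ∃ r ∈ l, c.1 ∈ r.1 ∧ c.2 ∈ r.2}

lemma exists_rectUnion [WellFoundedLT A] (D : LowerSet (A × A)) :
    ∃ l, rectUnion l = (D : Set (A × A)) := by
  refine ⟨(finite_range_sect D).toFinset.toList.map fun v =>
    (⟨{a | v ≤ sect D a}, fun _ _ h h' => h'.trans (sect_antitone D h)⟩, v), ?_⟩
  ext ⟨a, b⟩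
  constructor
  · rintro ⟨r, hr, ha, hb⟩
    obtain ⟨v, -, rfl⟩ := List.mem_map.1 hr
    exact ha hb
  · intro h
    exact ⟨_, List.mem_map.2 ⟨sect D a, by simp, rfl⟩, le_refl (sect D a), h⟩

lemma rectUnion_mono {l l' : List (LowerSet A × LowerSet A)}
    (h : List.SublistForall₂ (· ≤ ·) l l') : rectUnion l ⊆ rectUnion l' := by
  induction h with
  | nil => rintro c ⟨r, hr, -⟩; simp at hr
  | cons h _ ih =>
    rintro c ⟨r, hr, hc⟩
    rcases List.mem_cons.1 hr with rfl | hr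
    · exact ⟨_, List.mem_cons_self, h.1 hc.1, h.2 hc.2⟩
    · obtain ⟨r', hr', hc'⟩ := ih ⟨r, hr, hc⟩
      exact ⟨r', List.mem_cons_of_mem _ hr', hc'⟩
  | cons_right _ ih =>
    intro c hc
    obtain ⟨r', hr', hc'⟩ := ih hc
    exact ⟨r', List.mem_cons_of_mem _ hr', hc'⟩

instance wellQuasiOrderedLE_lowerSet [WellFoundedLT A] :
    WellQuasiOrderedLE (LowerSet (A × A)) := by
  refine ⟨fun D => ?_⟩
  choose l hl using fun n => exists_rectUnion (D n)
  have h := Set.PartiallyWellOrderedOn.partiallyWellOrderedOn_sublistForall₂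
    (α := LowerSet A × LowerSet A) (· ≤ ·) (s := Set.univ)
    (Set.partiallyWellOrderedOn_univ_iff.2 wellQuasiOrdered_le)
  obtain ⟨i, j, hij, h⟩ := h fun n => ⟨l n, fun x _ => Set.mem_univ x⟩
  refine ⟨i, j, hij, ?_⟩
  change (D i : Set (A × A)) ⊆ D j
  rw [← hl, ← hl]
  exact rectUnion_mono h

end wqo

namespace Sys
variable {X : Type u}

/-- The pairs of cardinals for which the system allows splitting. -/
def splitCode (S : Sys X) : LowerSet (Cardinal.{u} × Cardinal.{u}) :=
  ⟨{c | S.SplitIn c.1.out c.2.out}, fun c c' h H => H.of_le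
    (by simpa using h.1) (by simpa using h.2)⟩

/-- The pairs of cardinals for which the system allows merging. -/
def mergeCode (S : Sys X) : LowerSet (Cardinal.{u} × Cardinal.{u}) :=
  ⟨{c | S.MergeIn c.1.out c.2.out}, fun c c' h H => H.of_le
    (by simpa using h.1) (by simpa using h.2)⟩

/-- The natural numbers `n` for which `n` transversals collapse. -/
def colCode (S : Sys X) : LowerSet ℕ :=
  ⟨{n | S.Col (ULift.{u} (Fin n))}, fun c c' h H => H.of_le (by simpa using h)⟩

variable {S S' : Sys X} {J N : Type u}

lemma SplitIn.of_code (h : S.splitCode ≤ S'.splitCode) (H : S.SplitIn J N) : S'.SplitIn J N :=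
  (h (a := (#J, #N)) (H.of_le (by simp) (by simp)) : S'.SplitIn (#J).out (#N).out).of_le
    (by simp) (by simp)

lemma MergeIn.of_code (h : S.mergeCode ≤ S'.mergeCode) (H : S.MergeIn J N) : S'.MergeIn J N :=
  (h (a := (#J, #N)) (H.of_le (by simp) (by simp)) : S'.MergeIn (#J).out (#N).out).of_le
    (by simp) (by simp)

lemma Feat.of_code {P Q : Type u} {α β : Setoid (P ⊕ Q)} (h₁ : S.splitCode ≤ S'.splitCode)
    (h₂ : S.mergeCode ≤ S'.mergeCode) (h₃ : S.dual.mergeCode ≤ S'.dual.mergeCode)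
    (H : S.Feat J α β) : S'.Feat J α β :=
  ⟨H.1.of_code h₁, H.2.1.of_code h₂, H.2.2.of_code h₃⟩

lemma le_of_code [Infinite X] {σ σ' : Con (PMon X)}
    (h₁ : (ofCon σ).splitCode ≤ (ofCon σ').splitCode)
    (h₂ : (ofCon σ).mergeCode ≤ (ofCon σ').mergeCode)
    (h₃ : (ofCon σ).dual.mergeCode ≤ (ofCon σ').dual.mergeCode)
    (h₄ : ExcLe (ofCon σ) (ofCon σ')) : σ ≤ σ' := by
  intro α β H
  rw [← ofCon_rel] at H ⊢
  obtain ⟨J, a, b, C⟩ := Common.exists α β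
  rcases splitIn_or_exc C le_rfl le_rfl H with hs | he
  swap
  · exact rel_of_exc h₄ he
  rcases splitIn_or_exc C.symm le_rfl le_rfl ((ofCon σ).symm H) with hs' | he
  swap
  · exact (ofCon σ').symm (rel_of_exc h₄ he)
  exact rel_of_feat C ((feat C le_rfl le_rfl H hs hs').of_code h₁ h₂ h₃)
    ((feat C.symm le_rfl le_rfl ((ofCon σ).symm H) hs' hs).of_code h₁ h₂ h₃)

lemma exists_excLe [Infinite X] (S : ℕ → Sys X) (hS : Monotone fun i => (S i).colCode) :
    ∃ i j, i < j ∧ ExcLe (S i) (S j) := by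
  have hlt : ∀ {n m : ℕ}, n < m → #(ULift.{u} (Fin n)) < #(ULift.{u} (Fin m)) := by
    intro n m h
    simpa using h
  by_cases hc : ∃ i j, i < j ∧ (S i).colCode ≠ (S j).colCode
  · obtain ⟨i, j, hij, hne⟩ := hc
    obtain ⟨n, hn, hn'⟩ := Set.not_subset.1 ((hS hij.le).lt_of_ne hne).not_ge
    refine ⟨i, j, hij, fun m ω hm H hl hr => ?_⟩
    by_cases hω : ω = eT _
    · rw [hω]
      exact (S j).refl _
    refine rel_of_col ((S j).colCode.lower (not_lt.1 fun h => hn' ?_) hn) hl hr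
    exact col_of_lt H hl hr hω hm (hlt h)
  push Not at hc
  have hcode : ∀ i n, (S 0).Col (ULift.{u} (Fin n)) ↔ (S i).Col (ULift.{u} (Fin n)) := by
    intro i n
    rcases Nat.eq_zero_or_pos i with rfl | hi
    · rfl
    · exact (iff_of_eq (congrArg (n ∈ ·) (hc 0 i hi)) :)
  by_cases hall : ∀ n, (S 0).Col (ULift.{u} (Fin n))
  · exact ⟨0, 1, one_pos, fun n ω hn => absurd (hall n) hn⟩
  push Not at hall
  classical
  obtain ⟨L, hL, hmin⟩ : ∃ L, ¬ (S 0).Col (ULift.{u} (Fin L)) ∧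
      ∀ m < L, (S 0).Col (ULift.{u} (Fin m)) :=
    ⟨Nat.find hall, Nat.find_spec hall, fun m hm => not_not.1 (Nat.find_min hall hm)⟩
  have hfin : Finite (Setoid (ULift.{u} (Fin L) ⊕ ULift.{u} (Fin L))) :=
    Finite.of_injective (fun ω => {x : _ × _ | ω x.1 x.2}) fun ω ω' h => by
      ext x y
      exact Set.ext_iff.1 h (x, y)
  obtain ⟨i, j, hij, h⟩ := Finite.exists_ne_map_eq_of_infinite fun i =>
    {ω : Setoid (ULift.{u} (Fin L) ⊕ ULift.{u} (Fin L)) | (S i).rel (eT _) ω}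
  have key : ∀ i j, {ω : Setoid (ULift.{u} (Fin L) ⊕ ULift.{u} (Fin L)) | (S i).rel (eT _) ω} =
      {ω : Setoid (ULift.{u} (Fin L) ⊕ ULift.{u} (Fin L)) | (S j).rel (eT _) ω} →
      ExcLe (S i) (S j) := by
    intro i j h n ω hn H hl hr
    by_cases hω : ω = eT _
    · rw [hω]
      exact (S j).refl _
    rw [← hcode] at hn
    obtain rfl : n = L := by
      refine le_antisymm (not_lt.1 fun h => hL ?_) (not_lt.1 fun h => hn (hmin n h))
      rw [hcode i] at hn ⊢
      exact col_of_lt H hl hr hω hn (hlt h)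
    exact (Set.ext_iff.1 h ω).1 H
  rcases hij.lt_or_gt with hij | hij
  · exact ⟨i, j, hij, key i j h⟩
  · exact ⟨j, i, hij, key j i h.symm⟩

end Sys

instance wellQuasiOrderedLE_con {X : Type u} [Infinite X] :
    WellQuasiOrderedLE (Con (PMon X)) := by
  refine ⟨fun σ => ?_⟩
  obtain ⟨g, hg⟩ := (wellQuasiOrdered_le (α := LowerSet (Cardinal.{u} × Cardinal.{u}) ×
    LowerSet (Cardinal.{u} × Cardinal.{u}) × LowerSet (Cardinal.{u} × Cardinal.{u}) ×
      LowerSet ℕ)).exists_monotone_subseq fun n =>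
    ((ofCon (σ n)).splitCode, (ofCon (σ n)).mergeCode, (ofCon (σ n)).dual.mergeCode,
      (ofCon (σ n)).colCode)
  obtain ⟨i, j, hij, h⟩ := Sys.exists_excLe (fun n => ofCon (σ (g n)))
    fun i j hij => (hg i j hij).2.2.2
  have := hg i j hij.le
  exact ⟨g i, g j, g.lt_iff_lt.2 hij, Sys.le_of_code this.1 this.2.1 this.2.2.1 h⟩

/-- Theorem 6.2 (for `P_X`): the congruence lattice of the partition monoid over an
infinite set is well quasi-ordered under inclusion: there is no strictly descending
sequence of congruences, and every antichain of congruences is finite. -/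
theorem con_lattice_wqo [Infinite X] :
    (¬ ∃ f : ℕ → Con (PMon X), StrictAnti f) ∧
    (∀ A : Set (Con (PMon X)), IsAntichain (· ≤ ·) A → A.Finite) :=
  ⟨fun ⟨f, hf⟩ => not_strictAnti_of_wellFoundedLT f hf,
    fun _ hA => WellQuasiOrderedLE.finite_of_isAntichain hA⟩

end PartitionCongruences
end

section
/- Let X be a set with #X ≥ 2, and let PB_X denote the set of partitions over X all of whose blocks have at most 2 elements. Then the partition monoid P_X and the partial Brauer monoid PB_X are not isomorphic: there is no bijection φ : P_X → PB_X satisfying φ(α·β) = φ(α)·φ(β) for all α, β ∈ P_X (products computed in P_X). (Proposition 2.4.) -/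
open Cardinal
open scoped symmDiff

namespace PartitionCongruences

variable {X : Type*}

/-- A product relates only what is related by every setoid on the three copies of `X`
that contains both factors. -/
theorem mul_le_of_le {α β : PMon X} (S : Setoid (X ⊕ (X ⊕ X)))
    (hα : ∀ a b, α a b → S (dmap X a) (dmap X b))
    (hβ : ∀ a b, β a b → S (umap X a) (umap X b)) {a b : X ⊕ X} (h : (α * β) a b) :
    S (emap X a) (emap X b) := by
  have hd : push (dmap X) α ≤ S := Setoid.eqvGen_le <| by
    rintro _ _ ⟨x, y, hxy, rfl, rfl⟩
    exact hα x y hxy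
  have hu : push (umap X) β ≤ S := Setoid.eqvGen_le <| by
    rintro _ _ ⟨x, y, hxy, rfl, rfl⟩
    exact hβ x y hxy
  exact sup_le hd hu h

theorem join_of_left {α : PMon X} (β : PMon X) {a b : X ⊕ X} (h : α a b) :
    (push (dmap X) α ⊔ push (umap X) β) (dmap X a) (dmap X b) :=
  (le_sup_left : push (dmap X) α ≤ push (dmap X) α ⊔ push (umap X) β)
    (Relation.EqvGen.rel _ _ ⟨a, b, h, rfl, rfl⟩)

theorem join_of_right (α : PMon X) {β : PMon X} {a b : X ⊕ X} (h : β a b) :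
    (push (dmap X) α ⊔ push (umap X) β) (umap X a) (umap X b) :=
  (le_sup_right : push (umap X) β ≤ push (dmap X) α ⊔ push (umap X) β)
    (Relation.EqvGen.rel _ _ ⟨a, b, h, rfl, rfl⟩)

theorem mul_inl_inl_of_left {α : PMon X} (β : PMon X) {x y : X}
    (h : α (.inl x) (.inl y)) : (α * β) (.inl x) (.inl y) :=
  join_of_left β h

theorem mul_inr_inr_of_right (α : PMon X) {β : PMon X} {x y : X}
    (h : β (.inr x) (.inr y)) : (α * β) (.inr x) (.inr y) :=
  join_of_right α h

/-- In a product, an upper block of the left factor stays a block. -/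
theorem exists_of_mul_inl {α β : PMon X} {x : X} (hx : ∀ z, ¬ α (.inl x) (.inr z))
    {b : X ⊕ X} (h : (α * β) (.inl x) b) : ∃ y, b = .inl y ∧ α (.inl x) (.inl y) := by
  have key := mul_le_of_le
    (Setoid.ker fun t : X ⊕ (X ⊕ X) => ∃ w, t = .inl w ∧ α (.inl x) (.inl w)) ?_ ?_ h
  · have hb : ∃ w, emap X b = .inl w ∧ α (.inl x) (.inl w) :=
      (iff_of_eq key).1 ⟨x, rfl, α.refl _⟩
    rcases b with y | y
    · simpa [emap] using hb
    · simp [emap] at hb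
  · rintro (a | a) (b | b) hab
    · simpa [dmap, Setoid.ker_def] using
        (⟨fun h => α.trans h hab, fun h => α.trans h (α.symm hab)⟩ :
          α (.inl x) (.inl a) ↔ α (.inl x) (.inl b))
    · simpa [dmap, Setoid.ker_def] using fun h => hx b (α.trans h hab)
    · simpa [dmap, Setoid.ker_def] using fun h => hx a (α.trans h (α.symm hab))
    · simp [dmap, Setoid.ker_def]
  · rintro (a | a) (b | b) - <;> simp [umap, Setoid.ker_def]

/-- In a product, a lower block of the right factor stays a block. -/
theorem exists_of_mul_inr {α β : PMon X} {x : X} (hx : ∀ z, ¬ β (.inr x) (.inl z))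
    {b : X ⊕ X} (h : (α * β) (.inr x) b) : ∃ y, b = .inr y ∧ β (.inr x) (.inr y) := by
  have key := mul_le_of_le
    (Setoid.ker fun t : X ⊕ (X ⊕ X) => ∃ w, t = .inr (.inr w) ∧ β (.inr x) (.inr w)) ?_ ?_ h
  · have hb : ∃ w, emap X b = .inr (.inr w) ∧ β (.inr x) (.inr w) :=
      (iff_of_eq key).1 ⟨x, rfl, β.refl _⟩
    rcases b with y | y
    · simp [emap] at hb
    · simpa [emap] using hb
  · rintro (a | a) (b | b) - <;> simp [dmap, Setoid.ker_def]
  · rintro (a | a) (b | b) hab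
    · simp [umap, Setoid.ker_def]
    · simpa [umap, Setoid.ker_def] using fun h => hx a (β.trans h (β.symm hab))
    · simpa [umap, Setoid.ker_def] using fun h => hx b (β.trans h hab)
    · simpa [umap, Setoid.ker_def] using
        (⟨fun h => β.trans h hab, fun h => β.trans h (β.symm hab)⟩ :
          β (.inr x) (.inr a) ↔ β (.inr x) (.inr b))

theorem exists_left_of_mul {α β : PMon X} {x y : X} (h : (α * β) (.inl x) (.inr y)) :
    ∃ z, α (.inl x) (.inr z) := by
  by_contra! hx
  obtain ⟨w, hw, -⟩ := exists_of_mul_inl hx h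
  cases hw

theorem exists_right_of_mul {α β : PMon X} {x y : X} (h : (α * β) (.inl x) (.inr y)) :
    ∃ z, β (.inl z) (.inr y) := by
  by_contra! hy
  obtain ⟨w, hw, -⟩ := exists_of_mul_inr (fun z hz => hy z (β.symm hz)) ((α * β).symm h)
  cases hw

/-- A partition without transversals satisfies `ρ * (σ * ρ) = ρ` for every `σ`. -/
theorem mul_mul_self_of_no_transversal {ρ : PMon X}
    (hρ : ∀ x y, ¬ ρ (.inl x) (.inr y)) (σ : PMon X) : ρ * (σ * ρ) = ρ := by
  have hσ : ∀ x y, ¬ (σ * ρ) (.inl x) (.inr y) := fun x y h =>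
    (exists_right_of_mul h).elim fun z hz => hρ z y hz
  have hm : ∀ x y, ¬ (ρ * (σ * ρ)) (.inl x) (.inr y) := fun x y h =>
    (exists_left_of_mul h).elim fun z hz => hρ x z hz
  ext a b
  rcases a with x | x <;> rcases b with y | y
  · refine ⟨fun h => ?_, mul_inl_inl_of_left _⟩
    obtain ⟨w, hw, h'⟩ := exists_of_mul_inl (hρ x) h
    cases hw
    exact h'
  · exact iff_of_false (hm x y) (hρ x y)
  · exact iff_of_false (fun h => hm y x (Setoid.symm' _ h)) fun h => hρ y x (ρ.symm h)
  · refine ⟨fun h => ?_, fun h => mul_inr_inr_of_right _ (mul_inr_inr_of_right _ h)⟩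
    obtain ⟨w, hw, h'⟩ := exists_of_mul_inr (fun z hz => hσ z x (Setoid.symm' _ hz)) h
    cases hw
    obtain ⟨v, hv, h''⟩ := exists_of_mul_inr (fun z hz => hρ z x (ρ.symm hz)) h'
    cases hv
    exact h''

theorem mul_top_of_forall_exists {α : PMon X} (hα : ∀ x, ∃ y, α (.inl x) (.inr y)) :
    α * ⊤ = ⊤ := by
  have key : ∀ a : X ⊕ X, ∃ y : X,
      (push (dmap X) α ⊔ push (umap X) ⊤) (emap X a) (umap X (.inl y)) := by
    rintro (x | x)
    · obtain ⟨y, hy⟩ := hα x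
      exact ⟨y, join_of_left ⊤ hy⟩
    · exact ⟨x, join_of_right (β := ⊤) α (a := .inr x) (b := .inl x) trivial⟩
  refine top_unique fun {a b} _ => ?_
  obtain ⟨y, hy⟩ := key a
  obtain ⟨z, hz⟩ := key b
  change (push (dmap X) α ⊔ push (umap X) ⊤) (emap X a) (emap X b)
  exact Setoid.trans' _ hy (Setoid.trans' _
    (join_of_right (β := ⊤) α (a := .inl y) (b := .inl z) trivial) (Setoid.symm' _ hz))

/-- The partition with blocks `{x, (σ x)'}` attached to a permutation `σ`. -/
abbrev ofPerm (σ : Equiv.Perm X) : PMon X := Setoid.ker (Sum.elim σ id)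

theorem ofPerm_mul (σ : Equiv.Perm X) (β : PMon X) :
    ofPerm σ * β = Setoid.comap (Sum.map σ id) β := by
  have key : ∀ a : X ⊕ X, (push (dmap X) (ofPerm σ) ⊔ push (umap X) β)
      (emap X a) (umap X (Sum.map σ id a)) := by
    rintro (x | x)
    · exact join_of_left β (α := ofPerm σ) (a := .inl x) (b := .inr (σ x)) rfl
    · exact Setoid.refl' _ _
  ext a b
  constructor
  · intro h
    have := mul_le_of_le (Setoid.comap
      (Sum.elim (fun x => .inl (σ x)) id : X ⊕ (X ⊕ X) → X ⊕ X) β) ?_ ?_ h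
    · rcases a with a | a <;> rcases b with b | b <;> exact this
    · rintro (a | a) (b | b) hab <;>
      · change _ = _ at hab
        simp only [Sum.elim_inl, Sum.elim_inr, id] at hab
        subst_vars
        simp_all [dmap, Setoid.comap_rel]
    · rintro (a | a) (b | b) hab <;> exact hab
  · intro h
    change (push (dmap X) (ofPerm σ) ⊔ push (umap X) β) (emap X a) (emap X b)
    exact Setoid.trans' _ (key a)
      (Setoid.trans' _ (join_of_right (β := β) _ h) (Setoid.symm' _ (key b)))

theorem one_ofPerm_mul (β : PMon X) : ofPerm 1 * β = β := by
  rw [ofPerm_mul]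
  ext a b
  rcases a with a | a <;> rcases b with b | b <;> rfl

theorem ofPerm_mul_ofPerm (σ τ : Equiv.Perm X) :
    ofPerm σ * ofPerm τ = ofPerm (τ * σ) := by
  rw [ofPerm_mul]
  ext a b
  rcases a with a | a <;> rcases b with b | b <;> rfl

theorem card_block_ofPerm_le (σ : Equiv.Perm X) : ∀ B ∈ cl (ofPerm σ), #B ≤ 2 := by
  rintro _ ⟨a, rfl⟩
  have hsub : {x | ofPerm σ x a} ⊆
      {.inl (σ.symm (Sum.elim σ id a)), .inr (Sum.elim σ id a)} := by
    rintro (x | x) h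
    · left
      have h : σ x = Sum.elim σ id a := h
      rw [← h, σ.symm_apply_apply]
    · right
      have h : x = Sum.elim σ id a := h
      rw [← h]
      rfl
  refine (mk_le_mk_of_subset hsub).trans ((mk_insert_le).trans ?_)
  rw [mk_singleton, one_add_one_eq_two]

/-- A partition with blocks of size at most two that is fixed under left multiplication by
the transpositions has no transversals. -/
theorem no_transversal_of_swap_mul [DecidableEq X] [Nontrivial X] {ρ : PMon X}
    (hB : ∀ B ∈ cl ρ, #B ≤ 2) (hρ : ∀ x y : X, ofPerm (Equiv.swap x y) * ρ = ρ) (x y : X) :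
    ¬ ρ (.inl x) (.inr y) := by
  intro h
  obtain ⟨z, hz⟩ := exists_ne x
  have hzy : ρ (.inl z) (.inr y) := by
    rw [← hρ x z, ofPerm_mul]
    simpa [Setoid.comap_rel] using h
  have hle := hB _ ⟨.inr y, rfl⟩
  have h3 : ({.inl x, .inl z, .inr y} : Set (X ⊕ X)) ⊆ {t | ρ t (.inr y)} := by
    rintro t (rfl | rfl | rfl)
    exacts [h, hzy, ρ.refl _]
  have hc : #({.inl x, .inl z, .inr y} : Set (X ⊕ X)) = 3 := by
    rw [mk_insert (by simp [hz.symm]), mk_insert (by simp), mk_singleton]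
    norm_num
  have := (hc ▸ mk_le_mk_of_subset h3).trans hle
  exact absurd this (by norm_num)

/-- Proposition 2.4: for `#X ≥ 2`, the partition monoid `P_X` and the partial
Brauer monoid `PB_X` (partitions all of whose blocks have at most two elements)
are not isomorphic: no bijection between them respects the product of `P_X`. -/
theorem partition_not_iso_partialBrauer (h2 : 2 ≤ #X) :
    ¬ ∃ φ : PMon X ≃ {α : PMon X // ∀ B ∈ cl α, #↥B ≤ 2},
      ∀ α β : PMon X, (φ (α * β) : PMon X) = (φ α : PMon X) * (φ β : PMon X) := by
  classical
  rintro ⟨φ, hφ⟩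
  have : Nontrivial X := one_lt_iff_nontrivial.1 (lt_of_lt_of_le one_lt_two h2)
  have hinj : ∀ {α β : PMon X}, (φ α : PMon X) = φ β → α = β := fun h =>
    φ.injective (Subtype.ext h)
  have hpre : ∀ σ : Equiv.Perm X, ∃ α, (φ α : PMon X) = ofPerm σ := fun σ =>
    ⟨φ.symm ⟨ofPerm σ, card_block_ofPerm_le σ⟩, by rw [φ.apply_symm_apply]⟩
  obtain ⟨e, he⟩ := hpre 1
  have he_mul : ∀ β, e * β = β := fun β => hinj (by rw [hφ, he, one_ofPerm_mul])
  have he_trans : ∀ x, ∃ y, e (.inl x) (.inr y) := fun x => by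
    refine exists_left_of_mul (β := ofPerm 1) (y := x) ?_
    rw [he_mul]
    rfl
  have htop : ∀ x y : X, ofPerm (Equiv.swap x y) * (φ ⊤ : PMon X) = φ ⊤ := by
    intro x y
    obtain ⟨α, hα⟩ := hpre (Equiv.swap x y)
    have hαα : α * α = e := hinj (by
      rw [hφ, hα, he, ofPerm_mul_ofPerm, Equiv.swap_mul_self])
    rw [← hα, ← hφ, mul_top_of_forall_exists]
    intro z
    obtain ⟨w, hw⟩ := he_trans z
    rw [← hαα] at hw
    exact exists_left_of_mul hw
  have hfix : (⊤ : PMon X) * (⊥ * ⊤) = ⊤ := hinj (by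
    rw [hφ, hφ]
    exact mul_mul_self_of_no_transversal
      (no_transversal_of_swap_mul (φ ⊤).2 htop) _)
  obtain ⟨x⟩ : Nonempty X := inferInstance
  have hx : ((⊤ : PMon X) * (⊥ * ⊤)) (.inl x) (.inr x) := by
    rw [hfix]
    trivial
  obtain ⟨z, hz⟩ := exists_right_of_mul hx
  obtain ⟨w, hw⟩ := exists_left_of_mul hz
  cases (show (Sum.inl z : X ⊕ X) = Sum.inr w from hw)

end PartitionCongruences
end
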